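/- (*-Real Nullstellensatz) Let I be a *-ideal of ℂ[X₁,…,Xₙ]. Then I_ℂ(Z(I)) is a *-real *-ideal of ℂ[X₁,…,Xₙ] containing I, and I_ℂ(Z(I)) is contained in every *-real *-ideal of ℂ[X₁,…,Xₙ] that contains I; in other words, I_ℂ(Z(I)) equals the smallest *-real *-ideal containing I (the *-real radical of I). -/

import Mathlib

open MeasureTheory
open scoped ComplexOrder

noncomputable def evalC {n : ℕ} (P : MvPolynomial (Fin n) ℂ) (x : Fin n → ℝ) : ℂ :=
  MvPolynomial.aeval (fun i => (x i : ℂ)) P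

noncomputable def starC {n : ℕ} (P : MvPolynomial (Fin n) ℂ) : MvPolynomial (Fin n) ℂ :=
  MvPolynomial.map (starRingEnd ℂ) P

def IsPosDefC {n : ℕ} (Λ : MvPolynomial (Fin n) ℂ →ₗ[ℂ] ℂ) : Prop :=
  ∀ P : MvPolynomial (Fin n) ℂ, 0 ≤ Λ (starC P * P)

def IsMomentC {n : ℕ} (Λ : MvPolynomial (Fin n) ℂ →ₗ[ℂ] ℂ) : Prop :=
  ∃ μ : Measure (Fin n → ℝ),
    (∀ Q : MvPolynomial (Fin n) ℂ, Integrable (fun x => evalC Q x) μ) ∧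
    (∀ Q : MvPolynomial (Fin n) ℂ, Λ Q = ∫ x, evalC Q x ∂μ)

noncomputable def vanishingIdealC {n : ℕ} (Z : Set (Fin n → ℝ)) :
    Ideal (MvPolynomial (Fin n) ℂ) where
  carrier := {P | ∀ x ∈ Z, evalC P x = 0}
  add_mem' := by
    intro a b ha hb x hx
    simp only [Set.mem_setOf_eq, evalC, map_add] at *
    rw [ha x hx, hb x hx, add_zero]
  zero_mem' := by
    intro x hx
    simp [evalC]
  smul_mem' := by
    intro c a ha x hx
    simp only [Set.mem_setOf_eq, evalC, smul_eq_mul, map_mul] at *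
    rw [ha x hx, mul_zero]

def zeroSetC {n : ℕ} (I : Ideal (MvPolynomial (Fin n) ℂ)) : Set (Fin n → ℝ) :=
  {x | ∀ P ∈ I, evalC P x = 0}

def zSetC {n : ℕ} (P : MvPolynomial (Fin n) ℂ) : Set (Fin n → ℝ) :=
  {x | evalC P x = 0}

def VanishesOnC {n : ℕ} (Λ : MvPolynomial (Fin n) ℂ →ₗ[ℂ] ℂ)
    (I : Ideal (MvPolynomial (Fin n) ℂ)) : Prop :=
  ∀ P ∈ I, Λ P = 0

def nSetC {n : ℕ} (Λ : MvPolynomial (Fin n) ℂ →ₗ[ℂ] ℂ) : Set (MvPolynomial (Fin n) ℂ) :=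
  {P | Λ (starC P * P) = 0}

def IsTypeAC {n : ℕ} (P : MvPolynomial (Fin n) ℂ) : Prop :=
  ∀ Λ : MvPolynomial (Fin n) ℂ →ₗ[ℂ] ℂ,
    IsPosDefC Λ → VanishesOnC Λ (Ideal.span {P}) → IsMomentC Λ

section PolynomialIVT

open Polynomial

/-- The intermediate value property for polynomials over an ordered field. -/
def PolynomialIVT (R : Type*) [Field R] [LinearOrder R] : Prop :=
  ∀ (p : R[X]) (a b : R), a < b → p.eval a * p.eval b < 0 → ∃ c ∈ Set.Ioo a b, p.eval c = 0

variable {R : Type*} [Field R] [LinearOrder R]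

theorem polynomialIVT_real : PolynomialIVT ℝ := by
  intro p a b hab h
  have hc : ContinuousOn (fun x => p.eval x) (Set.Icc a b) := p.continuous.continuousOn
  rcases mul_neg_iff.1 h with ⟨h1, h2⟩ | ⟨h1, h2⟩
  · exact intermediate_value_Ioo' hab.le hc ⟨h2, h1⟩
  · exact intermediate_value_Ioo hab.le hc ⟨h1, h2⟩

variable [IsStrictOrderedRing R]

namespace PolynomialIVT

theorem sign_eq_of_le (hR : PolynomialIVT R) (p : R[X]) {a b : R} (hab : a ≤ b)
    (h : ∀ c ∈ Set.Icc a b, p.eval c ≠ 0) :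
    SignType.sign (p.eval a) = SignType.sign (p.eval b) := by
  rcases hab.eq_or_lt with rfl | hlt
  · rfl
  have ha := h a ⟨le_rfl, hab⟩
  have hb := h b ⟨hab, le_rfl⟩
  have hn : ¬ p.eval a * p.eval b < 0 := fun hneg => by
    obtain ⟨c, hc, hc0⟩ := hR p a b hlt hneg
    exact h c ⟨hc.1.le, hc.2.le⟩ hc0
  rcases lt_or_gt_of_ne ha with ha | ha <;> rcases lt_or_gt_of_ne hb with hb | hb
  · rw [sign_neg ha, sign_neg hb]
  · exact absurd (mul_neg_of_neg_of_pos ha hb) hn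
  · exact absurd (mul_neg_of_pos_of_neg ha hb) hn
  · rw [sign_pos ha, sign_pos hb]

theorem sign_eq (hR : PolynomialIVT R) (p : R[X]) {a b : R}
    (h : ∀ c ∈ Set.uIcc a b, p.eval c ≠ 0) :
    SignType.sign (p.eval a) = SignType.sign (p.eval b) := by
  rcases le_total a b with hab | hab
  · exact hR.sign_eq_of_le p hab (by rwa [Set.uIcc_of_le hab] at h)
  · exact (hR.sign_eq_of_le p hab (by rwa [Set.uIcc_of_ge hab] at h)).symm

/-- Rolle's theorem between consecutive roots. -/
theorem rolle_of_consecutive (hR : PolynomialIVT R) {p : R[X]} (hp : p ≠ 0) {a b : R} (hab : a < b)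
    (ha : p.eval a = 0) (hb : p.eval b = 0) (h : ∀ c ∈ Set.Ioo a b, p.eval c ≠ 0) :
    ∃ c ∈ Set.Ioo a b, (derivative p).eval c = 0 := by
  obtain ⟨s, hs, hsa⟩ := exists_eq_pow_rootMultiplicity_mul_and_not_dvd p hp a
  have hs0 : s ≠ 0 := by rintro rfl; simp at hsa
  obtain ⟨q, hq, hqb⟩ := exists_eq_pow_rootMultiplicity_mul_and_not_dvd s hs0 b
  have hm : p.rootMultiplicity a ≠ 0 := ((rootMultiplicity_pos hp).2 ha).ne'
  obtain ⟨m, hm⟩ := Nat.exists_eq_succ_of_ne_zero hm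
  have hsb : s.eval b = 0 := by
    rw [hs] at hb
    simpa [sub_ne_zero.2 hab.ne'] using hb
  obtain ⟨n, hn⟩ := Nat.exists_eq_succ_of_ne_zero ((rootMultiplicity_pos hs0).2 hsb).ne'
  rw [hm] at hs
  rw [hn] at hq
  rw [dvd_iff_isRoot, IsRoot.def] at hsa hqb
  have hqa : q.eval a ≠ 0 := by
    intro h0
    apply hsa
    rw [hq]
    simp [h0]
  have hq_ne : ∀ c ∈ Set.Icc a b, q.eval c ≠ 0 := by
    intro c hc h0
    rcases hc.1.eq_or_lt with rfl | h1
    · exact hqa h0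
    rcases hc.2.eq_or_lt with rfl | h2
    · exact hqb h0
    apply h c ⟨h1, h2⟩
    rw [hs, hq]
    simp [h0]
  have hsgn := hR.sign_eq_of_le q hab.le hq_ne
  have hpos : 0 < q.eval a * q.eval b := by
    rw [← sign_eq_one_iff, sign_mul, hsgn, ← sign_mul, sign_eq_one_iff]
    exact mul_self_pos.2 hqb
  set r : R[X] := C ((m : R) + 1) * (X - C b) * q + C ((n : R) + 1) * (X - C a) * q +
    (X - C a) * (X - C b) * derivative q with hr
  have hra : r.eval a = (m + 1) * (a - b) * q.eval a := by simp [hr]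
  have hrb : r.eval b = (n + 1) * (b - a) * q.eval b := by simp [hr]
  have hneg : r.eval a * r.eval b < 0 := by
    rw [hra, hrb]
    have h1 : 0 < ((m : R) + 1) * (n + 1) := by positivity
    have h2 : 0 < (b - a) * (b - a) := mul_self_pos.2 (sub_ne_zero.2 hab.ne')
    nlinarith [mul_pos (mul_pos h1 h2) hpos]
  obtain ⟨c, hc, hc0⟩ := hR r a b hab hneg
  refine ⟨c, hc, ?_⟩
  have hder : derivative p = (X - C a) ^ m * (X - C b) ^ n * r := by
    rw [hs, hq, hr]
    simp only [derivative_mul, derivative_X_sub_C_pow, Nat.succ_eq_add_one, Nat.add_sub_cancel,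
      C_add, C_1, map_natCast]
    push_cast
    ring
  rw [hder]
  simp [hc0]

theorem rolle (hR : PolynomialIVT R) (p : R[X]) {a b : R} (hab : a < b)
    (h : p.eval a = p.eval b) : ∃ c ∈ Set.Ioo a b, (derivative p).eval c = 0 := by
  classical
  by_cases h0 : p - C (p.eval a) = 0
  · obtain ⟨c, hc⟩ := exists_between hab
    refine ⟨c, hc, ?_⟩
    rw [sub_eq_zero.1 h0]
    simp
  set s := (p - C (p.eval a)).roots.toFinset.filter (a < ·) with hs
  have hmem : ∀ c, c ∈ s ↔ p.eval c = p.eval a ∧ a < c := by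
    intro c
    simp [hs, mem_roots h0, sub_eq_zero]
  have hbs : b ∈ s := (hmem b).2 ⟨h.symm, hab⟩
  have hd := (hmem _).1 (s.min'_mem ⟨b, hbs⟩)
  set d := s.min' ⟨b, hbs⟩ with hd_def
  have hdb : d ≤ b := s.min'_le b hbs
  obtain ⟨c, hc, hc0⟩ := hR.rolle_of_consecutive h0 hd.2 (by simp) (by simp [hd.1]) (by
    intro c hc hc0
    have : c ∈ s := (hmem c).2 ⟨by simpa [sub_eq_zero] using hc0, hc.1⟩
    exact absurd (s.min'_le c this) (not_le.2 hc.2))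
  exact ⟨c, ⟨hc.1, hc.2.trans_le hdb⟩, by simpa using hc0⟩

theorem strictMonoOn (hR : PolynomialIVT R) (p : R[X]) {a b : R}
    (h : ∀ c ∈ Set.Ioo a b, 0 < (derivative p).eval c) :
    StrictMonoOn (fun x => p.eval x) (Set.Icc a b) := by
  intro x hx y hy hxy
  set k := (p.eval y - p.eval x) / (y - x) with hk
  have hyx : 0 < y - x := sub_pos.2 hxy
  obtain ⟨c, hc, hc0⟩ := hR.rolle (p - C k * X) hxy (by
    have : k * (y - x) = p.eval y - p.eval x := by rw [hk]; field_simp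
    simp only [eval_sub, eval_mul, eval_C, eval_X]
    linear_combination this)
  have hck := h c ⟨hx.1.trans_lt hc.1, hc.2.trans_le hy.2⟩
  have : (derivative p).eval c = k := by simpa [sub_eq_zero] using hc0
  rw [this, hk, div_pos_iff_of_pos_right hyx, sub_pos] at hck
  exact hck

theorem exists_sign_eq_of_strictMonoOn {R' : Type*} [LinearOrder R'] [Zero R']
    (hR : PolynomialIVT R) {u : R' → R'} {a x b : R'}
    (hx : x ∈ Set.Ioo a b) (hu : StrictMonoOn u (Set.Icc a b)) (q : R[X]) {a' b' : R}
    (hab' : a' < b') (hq : StrictMonoOn (fun x => q.eval x) (Set.Icc a' b'))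
    (ha : SignType.sign (u a) = SignType.sign (q.eval a'))
    (hb : SignType.sign (u b) = SignType.sign (q.eval b')) :
    ∃ y ∈ Set.Ioo a' b', SignType.sign (u x) = SignType.sign (q.eval y) := by
  have hab : a < b := hx.1.trans hx.2
  have h1 : u a < u x := hu ⟨le_rfl, hab.le⟩ ⟨hx.1.le, hx.2.le⟩ hx.1
  have h2 : u x < u b := hu ⟨hx.1.le, hx.2.le⟩ ⟨hab.le, le_rfl⟩ hx.2
  have root : q.eval a' < 0 → 0 < q.eval b' → ∃ c ∈ Set.Ioo a' b', q.eval c = 0 :=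
    fun h h' => hR q a' b' hab' (mul_neg_of_neg_of_pos h h')
  rcases lt_trichotomy (u x) 0 with h | h | h
  · have hna : q.eval a' < 0 := by
      rw [← sign_eq_neg_one_iff, ← ha, sign_eq_neg_one_iff]; exact h1.trans h
    rw [sign_neg h]
    rcases le_or_gt (q.eval b') 0 with h0 | h0
    · obtain ⟨y, hy⟩ := exists_between hab'
      refine ⟨y, hy, (sign_neg ?_).symm⟩
      exact (hq ⟨hy.1.le, hy.2.le⟩ ⟨hab'.le, le_rfl⟩ hy.2).trans_le h0
    · obtain ⟨c, hc, hc0⟩ := root hna h0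
      obtain ⟨y, hy⟩ := exists_between hc.1
      refine ⟨y, ⟨hy.1, hy.2.trans hc.2⟩, (sign_neg ?_).symm⟩
      exact (hq ⟨hy.1.le, (hy.2.trans hc.2).le⟩ ⟨hc.1.le, hc.2.le⟩ hy.2).trans_eq hc0
  · have hna : q.eval a' < 0 := by
      rw [← sign_eq_neg_one_iff, ← ha, sign_eq_neg_one_iff]; exact h1.trans_eq h
    have hpb : 0 < q.eval b' := by
      rw [← sign_eq_one_iff, ← hb, sign_eq_one_iff]; exact h.symm.trans_lt h2
    obtain ⟨c, hc, hc0⟩ := root hna hpb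
    exact ⟨c, hc, by simp [h, hc0]⟩
  · have hpb : 0 < q.eval b' := by
      rw [← sign_eq_one_iff, ← hb, sign_eq_one_iff]; exact h.trans h2
    rw [sign_pos h]
    rcases le_or_gt 0 (q.eval a') with h0 | h0
    · obtain ⟨y, hy⟩ := exists_between hab'
      refine ⟨y, hy, (sign_pos ?_).symm⟩
      exact h0.trans_lt (hq ⟨le_rfl, hab'.le⟩ ⟨hy.1.le, hy.2.le⟩ hy.1)
    · obtain ⟨c, hc, hc0⟩ := root h0 hpb
      obtain ⟨y, hy⟩ := exists_between hc.2
      refine ⟨y, ⟨hc.1.trans hy.1, hy.2⟩, (sign_pos ?_).symm⟩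
      exact hc0.symm.trans_lt (hq ⟨hc.1.le, hc.2.le⟩ ⟨(hc.1.trans hy.1).le, hy.2.le⟩ hy.1)

end PolynomialIVT

theorem Polynomial.exists_forall_ge_le_eval (p : R[X]) (hp : 0 < p.leadingCoeff) :
    ∃ ε > 0, ∃ M : R, ∀ x ≥ M, ε ≤ p.eval x := by
  induction hn : p.natDegree generalizing p with
  | zero =>
    rw [eq_C_of_natDegree_eq_zero hn] at hp ⊢
    exact ⟨p.coeff 0, by simpa using hp, 0, by simp⟩
  | succ n ih =>
    have hdeg : p.divX.natDegree = n := by rw [natDegree_divX_eq_natDegree_tsub_one, hn]; simp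
    obtain ⟨ε, hε, M, hM⟩ := ih p.divX (by
      rwa [leadingCoeff, hdeg, coeff_divX, ← hn]) hdeg
    refine ⟨1, one_pos, max M (max 0 ((1 - p.coeff 0) / ε)), fun x hx => ?_⟩
    obtain ⟨h1, h2, h3⟩ : M ≤ x ∧ 0 ≤ x ∧ (1 - p.coeff 0) / ε ≤ x := by simpa using hx
    rw [← divX_mul_X_add p]
    rw [div_le_iff₀ hε] at h3
    have := mul_le_mul_of_nonneg_right (hM x h1) h2
    simp only [eval_add, eval_mul, eval_X, eval_C]
    linarith

theorem Polynomial.exists_forall_ge_sign_eval_eq (p : R[X]) :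
    ∃ M : R, ∀ x ≥ M, SignType.sign (p.eval x) = SignType.sign p.leadingCoeff := by
  rcases lt_trichotomy p.leadingCoeff 0 with h | h | h
  · obtain ⟨ε, hε, M, hM⟩ := exists_forall_ge_le_eval (-p) (by simpa using h)
    refine ⟨M, fun x hx => ?_⟩
    have := hM x hx
    rw [eval_neg] at this
    rw [sign_neg h, sign_neg (by linarith)]
  · exact ⟨0, by simp [leadingCoeff_eq_zero.1 h]⟩
  · obtain ⟨ε, hε, M, hM⟩ := exists_forall_ge_le_eval p h
    refine ⟨M, fun x hx => ?_⟩
    rw [sign_pos h, sign_pos (hε.trans_le (hM x hx))]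

theorem Polynomial.exists_forall_le_sign_eval_eq (p : R[X]) :
    ∃ M : R, ∀ x ≤ M, SignType.sign (p.eval x) =
      SignType.sign ((-1) ^ p.natDegree * p.leadingCoeff) := by
  obtain ⟨M, hM⟩ := exists_forall_ge_sign_eval_eq (p.comp (-X))
  refine ⟨-M, fun x hx => ?_⟩
  have := hM (-x) (by linarith)
  rw [leadingCoeff_comp (by simp)] at this
  simpa [mul_comm] using this

end PolynomialIVT

section SignMatch

open Polynomial

variable {B R₁ R₂ : Type*} [CommRing B]

/-- The sum of the terms of `q` of degree at most `j`. -/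
noncomputable def Polynomial.lowerPart (q : B[X]) (j : ℕ) : B[X] :=
  ∑ i ∈ Finset.range (j + 1), monomial i (q.coeff i)

theorem Polynomial.coeff_lowerPart (q : B[X]) (j i : ℕ) :
    (q.lowerPart j).coeff i = if i ≤ j then q.coeff i else 0 := by
  simp [lowerPart, coeff_monomial]

theorem Polynomial.natDegree_lowerPart_le (q : B[X]) (j : ℕ) : (q.lowerPart j).natDegree ≤ j := by
  rw [natDegree_le_iff_coeff_eq_zero]
  intro N hN
  rw [coeff_lowerPart, if_neg (by omega)]

theorem Polynomial.map_lowerPart {R : Type*} [CommRing R] (φ : B →+* R) (q : B[X]) :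
    (q.lowerPart (q.map φ).natDegree).map φ = q.map φ := by
  ext i
  rw [coeff_map, coeff_lowerPart]
  split_ifs with h
  · rw [coeff_map]
  · rw [map_zero, coeff_eq_zero_of_natDegree_lt (by omega)]

/-- Division with remainder after multiplying by an even power of the top coefficient. -/
theorem Polynomial.exists_pow_mul_eq_mul_add (t : B[X]) {j : ℕ} (hj : 0 < j) (ht : t.natDegree ≤ j)
    (p : B[X]) :
    ∃ (k : ℕ) (h u : B[X]), C (t.coeff j) ^ (2 * k) * p = t * h + u ∧ u.natDegree < j := by
  induction hd : p.natDegree using Nat.strong_induction_on generalizing p with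
  | _ d ih =>
    by_cases hdj : d < j
    · exact ⟨0, 0, p, by simp, by omega⟩
    set c := t.coeff j with hc
    set r : B[X] := C c * (C c * p - C (p.coeff d) * (X ^ (d - j) * t)) with hr
    have hrd : r.natDegree < d := by
      have : r.natDegree ≤ d - 1 := by
        rw [natDegree_le_iff_coeff_eq_zero]
        intro N hN
        rw [hr, coeff_C_mul, coeff_sub, coeff_C_mul, coeff_C_mul, coeff_X_pow_mul',
          if_pos (by omega)]
        rcases (show d ≤ N by omega).eq_or_lt with rfl | hlt
        · rw [show d - (d - j) = j by omega]
          ring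
        · rw [coeff_eq_zero_of_natDegree_lt (by omega : p.natDegree < N),
            coeff_eq_zero_of_natDegree_lt (by omega : t.natDegree < N - (d - j))]
          ring
      omega
    obtain ⟨k, h, u, hu, hud⟩ := ih _ hrd r rfl
    refine ⟨k + 1, h + C c ^ (2 * k + 1) * C (p.coeff d) * X ^ (d - j), u, ?_, hud⟩
    rw [hr] at hu
    linear_combination hu

variable [Field R₁] [LinearOrder R₁] [Field R₂] [LinearOrder R₂]

/-- Any finite configuration of points of `R₁` can be mapped monotonically into `R₂` without
changing the signs of the polynomials in `P`. -/
def SignMatch (φ₁ : B →+* R₁) (φ₂ : B →+* R₂) (P : Finset B[X]) : Prop :=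
  ∀ s : Finset R₁, ∃ f : R₁ → R₂, StrictMonoOn f s ∧ ∀ p ∈ P, ∀ x ∈ s,
    SignType.sign ((p.map φ₁).eval x) = SignType.sign ((p.map φ₂).eval (f x))

open Classical in
/-- The roots of those members of `A` whose image under `φ` does not vanish. -/
noncomputable def rootFinset (φ : B →+* R₁) (A : Finset B[X]) : Finset R₁ :=
  A.biUnion fun q => (q.map φ).roots.toFinset

theorem mem_rootFinset {φ : B →+* R₁} {A : Finset B[X]} {x : R₁} :
    x ∈ rootFinset φ A ↔ ∃ q ∈ A, q.map φ ≠ 0 ∧ (q.map φ).eval x = 0 := by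
  simp [rootFinset]

theorem coeff_eq_zero_iff_of_sign_eq {φ₁ : B →+* R₁} {φ₂ : B →+* R₂} {q : B[X]}
    (h : ∀ i, SignType.sign (φ₁ (q.coeff i)) = SignType.sign (φ₂ (q.coeff i))) (i : ℕ) :
    (q.map φ₁).coeff i = 0 ↔ (q.map φ₂).coeff i = 0 := by
  rw [coeff_map, coeff_map, ← sign_eq_zero_iff, h, sign_eq_zero_iff]

theorem map_eq_zero_iff_of_sign_eq {φ₁ : B →+* R₁} {φ₂ : B →+* R₂} {q : B[X]}
    (h : ∀ i, SignType.sign (φ₁ (q.coeff i)) = SignType.sign (φ₂ (q.coeff i))) :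
    q.map φ₁ = 0 ↔ q.map φ₂ = 0 := by
  simp only [Polynomial.ext_iff, coeff_zero, coeff_eq_zero_iff_of_sign_eq h]

theorem natDegree_map_eq_of_sign_eq {φ₁ : B →+* R₁} {φ₂ : B →+* R₂} {q : B[X]}
    (h : ∀ i, SignType.sign (φ₁ (q.coeff i)) = SignType.sign (φ₂ (q.coeff i))) :
    (q.map φ₁).natDegree = (q.map φ₂).natDegree := by
  apply le_antisymm <;> rw [natDegree_le_iff_coeff_eq_zero] <;> intro N hN
  · rw [coeff_eq_zero_iff_of_sign_eq h, coeff_eq_zero_of_natDegree_lt hN]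
  · rw [← coeff_eq_zero_iff_of_sign_eq h, coeff_eq_zero_of_natDegree_lt hN]

theorem SignMatch.mono {φ₁ : B →+* R₁} {φ₂ : B →+* R₂} {P Q : Finset B[X]} (hPQ : P ⊆ Q)
    (h : SignMatch φ₁ φ₂ Q) : SignMatch φ₁ φ₂ P := fun s => by
  obtain ⟨f, hf, hs⟩ := h s
  exact ⟨f, hf, fun p hp => hs p (hPQ hp)⟩

open Classical in
theorem image_rootFinset_subset {φ₁ : B →+* R₁} {φ₂ : B →+* R₂} {A : Finset B[X]}
    (hcoeff : ∀ q ∈ A, ∀ i, SignType.sign (φ₁ (q.coeff i)) = SignType.sign (φ₂ (q.coeff i)))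
    {f : R₁ → R₂} (hs : ∀ p ∈ A, ∀ x ∈ rootFinset φ₁ A,
      SignType.sign ((p.map φ₁).eval x) = SignType.sign ((p.map φ₂).eval (f x))) :
    (rootFinset φ₁ A).image f ⊆ rootFinset φ₂ A := by
  intro y hy
  obtain ⟨x, hx, rfl⟩ := Finset.mem_image.1 hy
  obtain ⟨q, hq, hq0, hqx⟩ := mem_rootFinset.1 hx
  refine mem_rootFinset.2 ⟨q, hq, ?_, ?_⟩
  · rwa [Ne, ← map_eq_zero_iff_of_sign_eq (hcoeff q hq)]
  · rw [← sign_eq_zero_iff, ← hs q hq x hx, hqx, sign_zero]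

open Classical in
theorem image_rootFinset {φ₁ : B →+* R₁} {φ₂ : B →+* R₂} {A : Finset B[X]}
    (hcoeff : ∀ q ∈ A, ∀ i, SignType.sign (φ₁ (q.coeff i)) = SignType.sign (φ₂ (q.coeff i)))
    (h21 : SignMatch φ₂ φ₁ A)
    {f : R₁ → R₂} (hf : StrictMonoOn f (rootFinset φ₁ A)) (hs : ∀ p ∈ A, ∀ x ∈ rootFinset φ₁ A,
      SignType.sign ((p.map φ₁).eval x) = SignType.sign ((p.map φ₂).eval (f x))) :
    (rootFinset φ₁ A).image f = rootFinset φ₂ A := by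
  apply Finset.eq_of_subset_of_card_le (image_rootFinset_subset hcoeff hs)
  obtain ⟨g, hg, hgs⟩ := h21 (rootFinset φ₂ A)
  rw [Finset.card_image_of_injOn hf.injOn, ← Finset.card_image_of_injOn hg.injOn]
  exact Finset.card_le_card
    (image_rootFinset_subset (fun q hq i => (hcoeff q hq i).symm) hgs)

variable [IsStrictOrderedRing R₁] [IsStrictOrderedRing R₂]

theorem PolynomialIVT.sign_eval_map_eq (hR : PolynomialIVT R₁) {φ : B →+* R₁} {A : Finset B[X]}
    {q : B[X]} (hq : q ∈ A) {y y' : R₁} (h : ∀ c ∈ rootFinset φ A, c ∉ Set.uIcc y y') :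
    SignType.sign ((q.map φ).eval y) = SignType.sign ((q.map φ).eval y') := by
  by_cases h0 : q.map φ = 0
  · simp [h0]
  · exact hR.sign_eq _ fun c hc hc0 => h c (mem_rootFinset.2 ⟨q, hq, h0, hc0⟩) hc

theorem sign_eval_map_eq_of_mul_eq (φ : B →+* R₁) {p q h u : B[X]} {j k : ℕ}
    (he : C (q.coeff j) ^ (2 * k) * p = q.lowerPart j * h + u) {z : R₁}
    (h1 : j = (q.map φ).natDegree) (h2 : (q.map φ).eval z = 0) (h3 : q.map φ ≠ 0) :
    SignType.sign ((p.map φ).eval z) = SignType.sign ((u.map φ).eval z) := by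
  have h4 := congrArg (fun r => (r.map φ).eval z) he
  have h5 : (q.lowerPart j).map φ = q.map φ := by rw [h1, map_lowerPart]
  simp only [Polynomial.map_mul, Polynomial.map_add, Polynomial.map_pow, map_C, h5, eval_add,
    eval_mul, h2, zero_mul, zero_add, eval_pow, eval_C] at h4
  have h6 : φ (q.coeff j) ≠ 0 := by
    rw [← coeff_map, h1]
    exact leadingCoeff_ne_zero.2 h3
  have h7 : 0 < φ (q.coeff j) ^ (2 * k) := by
    rw [pow_mul]
    exact pow_pos (sq_pos_of_ne_zero h6) k
  rw [← h4, sign_mul, sign_pos h7, one_mul]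

theorem sign_eval_eq_of_mem_rootFinset {φ₁ : B →+* R₁} {φ₂ : B →+* R₂} {A A' : Finset B[X]}
    {p : B[X]}
    (hcoeff : ∀ q ∈ A, ∀ i, SignType.sign (φ₁ (q.coeff i)) = SignType.sign (φ₂ (q.coeff i)))
    (hrem : ∀ q ∈ A, ∀ j, 0 < j → j ≤ q.natDegree →
      ∃ (k : ℕ) (h : B[X]), ∃ u ∈ A', C (q.coeff j) ^ (2 * k) * p = q.lowerPart j * h + u)
    {x : R₁} {y : R₂} (hx : x ∈ rootFinset φ₁ A)
    (hA : ∀ q ∈ A, SignType.sign ((q.map φ₁).eval x) = SignType.sign ((q.map φ₂).eval y))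
    (hA' : ∀ q ∈ A', SignType.sign ((q.map φ₁).eval x) = SignType.sign ((q.map φ₂).eval y)) :
    SignType.sign ((p.map φ₁).eval x) = SignType.sign ((p.map φ₂).eval y) := by
  obtain ⟨q, hq, hq0, hqx⟩ := mem_rootFinset.1 hx
  have hc := hcoeff q hq
  have hqy : (q.map φ₂).eval y = 0 := by
    rw [← sign_eq_zero_iff, ← hA q hq, hqx, sign_zero]
  set j := (q.map φ₁).natDegree with hj
  have hj' : j = (q.map φ₂).natDegree := natDegree_map_eq_of_sign_eq hc
  have hj0 : 0 < j := by
    rw [Nat.pos_iff_ne_zero]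
    intro h0
    rw [eq_C_of_natDegree_eq_zero h0, eval_C] at hqx
    exact hq0 (by rw [eq_C_of_natDegree_eq_zero h0, hqx, C_0])
  obtain ⟨k, h, u, hu, he⟩ := hrem q hq j hj0 natDegree_map_le
  rw [sign_eval_map_eq_of_mul_eq φ₁ he hj hqx hq0, hA' u hu,
    sign_eval_map_eq_of_mul_eq φ₂ he hj' hqy (by rwa [Ne, ← map_eq_zero_iff_of_sign_eq hc])]

theorem sign_eval_neg (p : R₁[X]) (z : R₁) :
    SignType.sign ((-p).eval z) = - SignType.sign (p.eval z) := by
  rw [eval_neg, Left.sign_neg]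

theorem PolynomialIVT.exists_sign_eq (hR₂ : PolynomialIVT R₂) (hR₁ : PolynomialIVT R₁)
    {p : R₁[X]} {q : R₂[X]} {a x b : R₁} {a' b' : R₂} (hx : x ∈ Set.Ioo a b) (hab' : a' < b')
    {σ : SignType} (hσ : σ ≠ 0)
    (hp : ∀ c ∈ Set.Ioo a b, SignType.sign ((derivative p).eval c) = σ)
    (hq : ∀ c ∈ Set.Ioo a' b', SignType.sign ((derivative q).eval c) = σ)
    (ha : SignType.sign (p.eval a) = SignType.sign (q.eval a'))
    (hb : SignType.sign (p.eval b) = SignType.sign (q.eval b')) :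
    ∃ y ∈ Set.Ioo a' b', SignType.sign (p.eval x) = SignType.sign (q.eval y) := by
  cases σ with
  | zero => exact absurd rfl hσ
  | pos =>
    exact hR₂.exists_sign_eq_of_strictMonoOn (u := fun z => p.eval z) hx
      (hR₁.strictMonoOn p fun c hc => sign_eq_one_iff.1 (hp c hc)) q hab'
      (hR₂.strictMonoOn q fun c hc => sign_eq_one_iff.1 (hq c hc)) ha hb
  | neg =>
    obtain ⟨y, hy, h⟩ := hR₂.exists_sign_eq_of_strictMonoOn (u := fun z => (-p).eval z) hx
      (hR₁.strictMonoOn (-p) fun c hc => sign_eq_one_iff.1 (by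
        rw [derivative_neg, sign_eval_neg, hp c hc]; rfl)) (-q) hab'
      (hR₂.strictMonoOn (-q) fun c hc => sign_eq_one_iff.1 (by
        rw [derivative_neg, sign_eval_neg, hq c hc]; rfl))
      (by rw [sign_eval_neg, sign_eval_neg, ha]) (by rw [sign_eval_neg, sign_eval_neg, hb])
    rw [sign_eval_neg, sign_eval_neg, neg_inj] at h
    exact ⟨y, hy, h⟩

end SignMatch

section SignMatchInsert

open Polynomial

variable {B R₁ R₂ : Type*} [CommRing B] [Field R₁] [LinearOrder R₁] [IsStrictOrderedRing R₁]
  [Field R₂] [LinearOrder R₂] [IsStrictOrderedRing R₂]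

open Classical in
/-- Adding one more point to a sign preserving configuration that already contains all roots of
the polynomials in `A`. -/
theorem exists_strictMonoOn_insert (hR₁ : PolynomialIVT R₁) (hR₂ : PolynomialIVT R₂)
    {φ₁ : B →+* R₁} {φ₂ : B →+* R₂} {A : Finset B[X]} {p : B[X]}
    (hder : derivative p ∈ A) (hder0 : derivative (p.map φ₁) ≠ 0)
    {s Y : Finset R₁} {g f : R₁ → R₂} (hg : StrictMonoOn g s)
    (hgA : ∀ q ∈ A, ∀ x ∈ s, SignType.sign ((q.map φ₁).eval x) =
      SignType.sign ((q.map φ₂).eval (g x)))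
    (hroots : rootFinset φ₁ A ⊆ s) (himage : (rootFinset φ₁ A).image g = rootFinset φ₂ A)
    (hf : StrictMonoOn f Y)
    (hfs : ∀ q ∈ insert p A, ∀ x ∈ Y, SignType.sign ((q.map φ₁).eval x) =
      SignType.sign ((q.map φ₂).eval (f x)))
    (hY : rootFinset φ₁ A ⊆ Y) (hfg : ∀ e ∈ rootFinset φ₁ A, f e = g e)
    {x : R₁} (hxs : x ∈ s) (hx : x ∉ Y) (hlow : ∃ a ∈ Y, a < x) (hup : ∃ b ∈ Y, x < b) :
    ∃ y, StrictMonoOn (Function.update f x y) (insert x Y : Finset R₁) ∧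
      ∀ q ∈ insert p A, SignType.sign ((q.map φ₁).eval x) = SignType.sign ((q.map φ₂).eval y) := by
  obtain ⟨a, ha, hamax⟩ : ∃ a ∈ Y.filter (· < x), ∀ z ∈ Y.filter (· < x), z ≤ a :=
    Finset.exists_max_image _ id (by obtain ⟨a, h⟩ := hlow; exact ⟨a, by simpa using h⟩)
  obtain ⟨b, hb, hbmin⟩ : ∃ b ∈ Y.filter (x < ·), ∀ z ∈ Y.filter (x < ·), b ≤ z :=
    Finset.exists_min_image _ id (by obtain ⟨a, h⟩ := hup; exact ⟨a, by simpa using h⟩)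
  simp only [Finset.mem_filter, and_imp] at ha hb hamax hbmin
  have hlt : ∀ z ∈ Y, z < x → f z ≤ f a := fun z hz h => hf.monotoneOn hz ha.1 (hamax z hz h)
  have hgt : ∀ z ∈ Y, x < z → f b ≤ f z := fun z hz h => hf.monotoneOn hb.1 hz (hbmin z hz h)
  have hfab : f a < f b := hf ha.1 hb.1 (ha.2.trans hb.2)
  have hsign1 : ∀ q ∈ A, ∀ c ∈ Set.Ioo a b,
      SignType.sign ((q.map φ₁).eval c) = SignType.sign ((q.map φ₁).eval x) := by
    intro q hq c hc
    refine hR₁.sign_eval_map_eq hq fun e he hmem => ?_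
    have hab : e ∈ Set.Ioo a b := by
      refine ⟨?_, ?_⟩
      · exact (lt_min hc.1 ha.2).trans_le hmem.1
      · exact hmem.2.trans_lt (max_lt hc.2 hb.2)
    rcases lt_trichotomy e x with h | h | h
    · exact absurd (hamax e (hY he) h) (not_le.2 hab.1)
    · exact hx (h ▸ hY he)
    · exact absurd (hbmin e (hY he) h) (not_le.2 hab.2)
  have hsign2 : ∀ q ∈ A, ∀ y ∈ Set.Ioo (f a) (f b),
      SignType.sign ((q.map φ₁).eval x) = SignType.sign ((q.map φ₂).eval y) := by
    intro q hq y hy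
    rw [hgA q hq x hxs]
    refine hR₂.sign_eval_map_eq hq fun e' he' hmem => ?_
    rw [← himage] at he'
    obtain ⟨e, he, rfl⟩ := Finset.mem_image.1 he'
    rcases lt_trichotomy e x with h | h | h
    · have h1 : g e < g x := hg (hroots he) hxs h
      have h2 : g e < y := by
        rw [← hfg e he]
        exact (hlt e (hY he) h).trans_lt hy.1
      exact absurd hmem.1 (not_le.2 (lt_min h1 h2))
    · exact hx (h ▸ hY he)
    · have h1 : g x < g e := hg hxs (hroots he) h
      have h2 : y < g e := by
        rw [← hfg e he]
        exact hy.2.trans_le (hgt e (hY he) h)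
      exact absurd hmem.2 (not_le.2 (max_lt h1 h2))
  have hder' : (derivative (p.map φ₁)).eval x ≠ 0 := fun h0 => hx <| hY <| mem_rootFinset.2
    ⟨_, hder, by rwa [← derivative_map], by rwa [← derivative_map]⟩
  obtain ⟨y, hy, hpy⟩ := hR₂.exists_sign_eq hR₁ (p := p.map φ₁) (q := p.map φ₂) ⟨ha.2, hb.2⟩ hfab
    (σ := SignType.sign ((derivative (p.map φ₁)).eval x)) (by rwa [Ne, sign_eq_zero_iff])
    (by simpa only [derivative_map] using hsign1 _ hder)
    (by
      intro c hc
      simpa only [derivative_map] using (hsign2 _ hder c hc).symm)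
    (hfs p (Finset.mem_insert_self _ _) a ha.1) (hfs p (Finset.mem_insert_self _ _) b hb.1)
  refine ⟨y, ?_, fun q hq => ?_⟩
  · have hne : ∀ z ∈ Y, z ≠ x := fun z hz h => hx (h ▸ hz)
    intro z hz w hw hzw
    rcases Finset.mem_insert.1 (Finset.mem_coe.1 hz) with rfl | hz'
    · rcases Finset.mem_insert.1 (Finset.mem_coe.1 hw) with rfl | hw'
      · exact absurd hzw (lt_irrefl _)
      · rw [Function.update_self, Function.update_of_ne (hne w hw')]
        exact hy.2.trans_le (hgt w hw' hzw)
    · rcases Finset.mem_insert.1 (Finset.mem_coe.1 hw) with rfl | hw'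
      · rw [Function.update_self, Function.update_of_ne (hne z hz')]
        exact (hlt z hz' hzw).trans_lt hy.1
      · rw [Function.update_of_ne (hne w hw'), Function.update_of_ne (hne z hz')]
        exact hf hz' hw' hzw
  · rcases Finset.mem_insert.1 hq with rfl | hq
    · exact hpy
    · exact hsign2 q hq y hy

theorem exists_lt_and_sign_eval_map (φ : B →+* R₁) (p : B[X]) (s : Finset R₁) :
    ∃ m, (∀ x ∈ s, m < x) ∧ SignType.sign ((p.map φ).eval m) =
      SignType.sign ((-1) ^ (p.map φ).natDegree * (p.map φ).leadingCoeff) := by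
  classical
  obtain ⟨M, hM⟩ := (p.map φ).exists_forall_le_sign_eval_eq
  obtain ⟨b, hb⟩ : ∃ b, ∀ x ∈ insert M s, b ≤ x :=
    ⟨(insert M s).min' (Finset.insert_nonempty M s), fun x hx => Finset.min'_le _ x hx⟩
  refine ⟨b - 1, fun x hx => ?_, hM _ ?_⟩
  · exact (sub_one_lt b).trans_le (hb x (Finset.mem_insert_of_mem hx))
  · exact (sub_one_lt b).le.trans (hb M (Finset.mem_insert_self _ _))

theorem exists_gt_and_sign_eval_map (φ : B →+* R₁) (p : B[X]) (s : Finset R₁) :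
    ∃ m, (∀ x ∈ s, x < m) ∧ SignType.sign ((p.map φ).eval m) =
      SignType.sign (p.map φ).leadingCoeff := by
  classical
  obtain ⟨M, hM⟩ := (p.map φ).exists_forall_ge_sign_eval_eq
  obtain ⟨b, hb⟩ := (insert M s).exists_le
  refine ⟨b + 1, fun x hx => ?_, hM _ ?_⟩
  · exact (hb x (Finset.mem_insert_of_mem hx)).trans_lt (lt_add_one b)
  · exact (hb M (Finset.mem_insert_self _ _)).trans (lt_add_one b).le

end SignMatchInsert

section SignMatchStep

open Polynomial

variable {B R₁ R₂ : Type*} [CommRing B] [Field R₁] [LinearOrder R₁] [IsStrictOrderedRing R₁]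
  [Field R₂] [LinearOrder R₂] [IsStrictOrderedRing R₂]

open Classical in
theorem SignMatch.insert_of_derivative_ne_zero (hR₁ : PolynomialIVT R₁) (hR₂ : PolynomialIVT R₂)
    {φ₁ : B →+* R₁} {φ₂ : B →+* R₂} {A A' : Finset B[X]} {p : B[X]} (hAA' : A ⊆ A')
    (hcoeff : ∀ q ∈ insert p A, ∀ i,
      SignType.sign (φ₁ (q.coeff i)) = SignType.sign (φ₂ (q.coeff i)))
    (hlead : φ₁ p.leadingCoeff ≠ 0)
    (hder : derivative p ∈ A) (hder0 : derivative (p.map φ₁) ≠ 0)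
    (hrem : ∀ q ∈ A, ∀ j, 0 < j → j ≤ q.natDegree →
      ∃ (k : ℕ) (h : B[X]), ∃ u ∈ A', C (q.coeff j) ^ (2 * k) * p = q.lowerPart j * h + u)
    (h12 : SignMatch φ₁ φ₂ A') (h21 : SignMatch φ₂ φ₁ A') :
    SignMatch φ₁ φ₂ (insert p A) := by
  intro X
  have hcA : ∀ q ∈ A, ∀ i, SignType.sign (φ₁ (q.coeff i)) = SignType.sign (φ₂ (q.coeff i)) :=
    fun q hq => hcoeff q (Finset.mem_insert_of_mem hq)
  have hcp := hcoeff p (Finset.mem_insert_self _ _)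
  have hlead₂ : φ₂ p.leadingCoeff ≠ 0 := by
    rw [← sign_ne_zero, leadingCoeff, ← hcp, sign_ne_zero]
    exact hlead
  obtain ⟨m, hm, hmp⟩ := exists_lt_and_sign_eval_map φ₁ p (X ∪ rootFinset φ₁ A)
  obtain ⟨M, hM, hMp⟩ := exists_gt_and_sign_eval_map φ₁ p (insert m (X ∪ rootFinset φ₁ A))
  set s := insert m (insert M (X ∪ rootFinset φ₁ A)) with hs
  obtain ⟨g, hg, hgs⟩ := h12 s
  have hms : m ∈ s := Finset.mem_insert_self _ _
  have hMs : M ∈ s := Finset.mem_insert_of_mem (Finset.mem_insert_self _ _)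
  have hXs : X ⊆ s := fun x hx => by simp [hs, hx]
  have hroots : rootFinset φ₁ A ⊆ s := fun x hx => by simp [hs, hx]
  have hgA : ∀ q ∈ A, ∀ x ∈ s, SignType.sign ((q.map φ₁).eval x) =
      SignType.sign ((q.map φ₂).eval (g x)) := fun q hq => hgs q (hAA' hq)
  have himage : (rootFinset φ₁ A).image g = rootFinset φ₂ A :=
    image_rootFinset hcA (h21.mono hAA') (hg.mono (by exact_mod_cast hroots))
      fun q hq x hx => hgA q hq x (hroots hx)
  have hmlt : ∀ x ∈ X ∪ rootFinset φ₁ A, m < x := hm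
  have hltM : ∀ x ∈ X ∪ rootFinset φ₁ A, x < M := fun x hx => hM x (Finset.mem_insert_of_mem hx)
  have hmM : m < M := hM m (Finset.mem_insert_self _ _)
  obtain ⟨m', hm', hmp'⟩ := exists_lt_and_sign_eval_map φ₂ p (s.image g)
  obtain ⟨M', hM', hMp'⟩ := exists_gt_and_sign_eval_map φ₂ p (s.image g)
  have hm'g : ∀ x ∈ s, m' < g x := fun x hx => hm' _ (Finset.mem_image_of_mem g hx)
  have hM'g : ∀ x ∈ s, g x < M' := fun x hx => hM' _ (Finset.mem_image_of_mem g hx)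
  set f₀ : R₁ → R₂ := Function.update (Function.update g M M') m m' with hf₀
  have hf₀m : f₀ m = m' := Function.update_self ..
  have hf₀M : f₀ M = M' := by
    rw [hf₀, Function.update_of_ne hmM.ne', Function.update_self]
  have hf₀g : ∀ e ∈ rootFinset φ₁ A, f₀ e = g e := fun e he => by
    have he' : e ∈ X ∪ rootFinset φ₁ A := Finset.mem_union_right _ he
    rw [hf₀, Function.update_of_ne (hmlt e he').ne', Function.update_of_ne (hltM e he').ne]
  set Y₀ := insert m (insert M (rootFinset φ₁ A)) with hY₀
  have hf₀mono : StrictMonoOn f₀ Y₀ := by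
    intro z hz w hw hzw
    simp only [hY₀, Finset.coe_insert, Set.mem_insert_iff, Finset.mem_coe] at hz hw
    have hmlt' : ∀ x ∈ rootFinset φ₁ A, m < x := fun x hx => hmlt x (Finset.mem_union_right _ hx)
    have hltM' : ∀ x ∈ rootFinset φ₁ A, x < M := fun x hx => hltM x (Finset.mem_union_right _ hx)
    rcases hz with rfl | rfl | hz <;> rcases hw with rfl | rfl | hw
    · exact absurd hzw (lt_irrefl _)
    · rw [hf₀m, hf₀M]
      exact (hm'g _ hms).trans (hM'g _ hms)
    · rw [hf₀m, hf₀g _ hw]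
      exact hm'g _ (hroots hw)
    · exact absurd hzw hmM.not_gt
    · exact absurd hzw (lt_irrefl _)
    · exact absurd hzw (hltM' _ hw).not_gt
    · exact absurd hzw (hmlt' _ hz).not_gt
    · rw [hf₀M, hf₀g _ hz]
      exact hM'g _ (hroots hz)
    · rw [hf₀g _ hz, hf₀g _ hw]
      exact hg (hroots hz) (hroots hw) hzw
  have hdeg : (p.map φ₁).natDegree = (p.map φ₂).natDegree := natDegree_map_eq_of_sign_eq hcp
  have hlc : SignType.sign (p.map φ₁).leadingCoeff = SignType.sign (p.map φ₂).leadingCoeff := by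
    rw [leadingCoeff_map_of_leadingCoeff_ne_zero _ hlead,
      leadingCoeff_map_of_leadingCoeff_ne_zero _ hlead₂]
    exact hcp _
  have hsignpow : ∀ k : ℕ, SignType.sign ((-1 : R₁) ^ k) = SignType.sign ((-1 : R₂) ^ k) := by
    intro k
    rw [sign_pow, sign_pow, Left.sign_neg, Left.sign_neg, sign_one, sign_one]
  have hf₀s : ∀ q ∈ insert p A, ∀ x ∈ Y₀, SignType.sign ((q.map φ₁).eval x) =
      SignType.sign ((q.map φ₂).eval (f₀ x)) := by
    intro q hq x hx
    simp only [hY₀, Finset.mem_insert] at hx hq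
    rcases hx with rfl | rfl | hx
    · rw [hf₀m]
      rcases hq with rfl | hq
      · rw [hmp, hmp', sign_mul, sign_mul, hdeg, hlc, hsignpow]
      · rw [hgA q hq _ hms]
        refine (hR₂.sign_eval_map_eq hq fun e' he' hmem => ?_).symm
        rw [← himage] at he'
        obtain ⟨e, he, rfl⟩ := Finset.mem_image.1 he'
        rw [Set.uIcc_of_le (hm'g _ hms).le] at hmem
        exact absurd hmem.2
          (not_le.2 (hg hms (hroots he) (hmlt e (Finset.mem_union_right _ he))))
    · rw [hf₀M]
      rcases hq with rfl | hq
      · rw [hMp, hMp', hlc]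
      · rw [hgA q hq _ hMs]
        refine hR₂.sign_eval_map_eq hq fun e' he' hmem => ?_
        rw [← himage] at he'
        obtain ⟨e, he, rfl⟩ := Finset.mem_image.1 he'
        rw [Set.uIcc_of_le (hM'g _ hMs).le] at hmem
        exact absurd hmem.1
          (not_le.2 (hg (hroots he) hMs (hltM e (Finset.mem_union_right _ he))))
    · rw [hf₀g x hx]
      rcases hq with rfl | hq
      · exact sign_eval_eq_of_mem_rootFinset hcA hrem hx (fun q hq => hgA q hq x (hroots hx))
          fun q hq => hgs q hq x (hroots hx)
      · exact hgA q hq x (hroots hx)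
  have main : ∀ X' ⊆ X, ∃ (Y : Finset R₁) (f : R₁ → R₂), X' ⊆ Y ∧ Y₀ ⊆ Y ∧ StrictMonoOn f Y ∧
      (∀ q ∈ insert p A, ∀ x ∈ Y, SignType.sign ((q.map φ₁).eval x) =
        SignType.sign ((q.map φ₂).eval (f x))) ∧ ∀ e ∈ rootFinset φ₁ A, f e = g e := by
    intro X' hX'
    induction X' using Finset.induction_on with
    | empty => exact ⟨Y₀, f₀, Finset.empty_subset _, subset_rfl, hf₀mono, hf₀s, hf₀g⟩
    | insert x X' hxX' ih =>
      obtain ⟨Y, f, hY, hY₀Y, hf, hfs, hfg⟩ := ih ((Finset.subset_insert _ _).trans hX')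
      have hxX : x ∈ X := hX' (Finset.mem_insert_self _ _)
      have hrY : rootFinset φ₁ A ⊆ Y := fun e he => hY₀Y (by simp [hY₀, he])
      by_cases hxY : x ∈ Y
      · exact ⟨Y, f, Finset.insert_subset hxY hY, hY₀Y, hf, hfs, hfg⟩
      obtain ⟨y, hy, hys⟩ := exists_strictMonoOn_insert hR₁ hR₂ hder hder0 hg hgA hroots himage hf
        hfs hrY hfg (hXs hxX) hxY
        ⟨m, hY₀Y (by simp [hY₀]), hmlt x (Finset.mem_union_left _ hxX)⟩
        ⟨M, hY₀Y (by simp [hY₀]), hltM x (Finset.mem_union_left _ hxX)⟩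
      refine ⟨insert x Y, Function.update f x y, Finset.insert_subset_insert _ hY,
        hY₀Y.trans (Finset.subset_insert _ _), hy, fun q hq z hz => ?_, fun e he => ?_⟩
      · rcases Finset.mem_insert.1 hz with rfl | hz
        · rw [Function.update_self]
          exact hys q hq
        · have hzx : z ≠ x := fun h => hxY (h ▸ hz)
          rw [Function.update_of_ne hzx]
          exact hfs q hq z hz
      · have hex : e ≠ x := fun h => hxY (h ▸ hrY he)
        rw [Function.update_of_ne hex]
        exact hfg e he
  obtain ⟨Y, f, hXY, -, hf, hfs, -⟩ := main X subset_rfl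
  exact ⟨f, hf.mono (by exact_mod_cast hXY), fun q hq x hx => hfs q hq x (hXY hx)⟩

open Classical in
theorem SignMatch.insert (hR₁ : PolynomialIVT R₁) (hR₂ : PolynomialIVT R₂)
    {φ₁ : B →+* R₁} {φ₂ : B →+* R₂} {A A' : Finset B[X]} {p : B[X]} (hAA' : A ⊆ A')
    (hcoeff : ∀ q ∈ insert p A, ∀ i,
      SignType.sign (φ₁ (q.coeff i)) = SignType.sign (φ₂ (q.coeff i)))
    (hder : derivative p ∈ A) (herase : p.eraseLead ∈ A')
    (hrem : ∀ q ∈ A, ∀ j, 0 < j → j ≤ q.natDegree →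
      ∃ (k : ℕ) (h : B[X]), ∃ u ∈ A', C (q.coeff j) ^ (2 * k) * p = q.lowerPart j * h + u)
    (h12 : SignMatch φ₁ φ₂ A') (h21 : SignMatch φ₂ φ₁ A') :
    SignMatch φ₁ φ₂ (insert p A) := by
  have hcp := hcoeff p (Finset.mem_insert_self _ _)
  by_cases hlead : φ₁ p.leadingCoeff = 0
  · have hlead₂ : φ₂ p.leadingCoeff = 0 := by
      rw [← sign_eq_zero_iff, leadingCoeff, ← hcp, sign_eq_zero_iff]
      exact hlead
    have h1 : p.map φ₁ = p.eraseLead.map φ₁ := by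
      conv_lhs => rw [← eraseLead_add_monomial_natDegree_leadingCoeff p]
      rw [Polynomial.map_add, map_monomial, hlead, monomial_zero_right, add_zero]
    have h2 : p.map φ₂ = p.eraseLead.map φ₂ := by
      conv_lhs => rw [← eraseLead_add_monomial_natDegree_leadingCoeff p]
      rw [Polynomial.map_add, map_monomial, hlead₂, monomial_zero_right, add_zero]
    intro X
    obtain ⟨f, hf, hfs⟩ := h12 X
    refine ⟨f, hf, fun q hq x hx => ?_⟩
    rcases Finset.mem_insert.1 hq with rfl | hq
    · rw [h1, h2]
      exact hfs _ herase x hx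
    · exact hfs q (hAA' hq) x hx
  by_cases hder0 : derivative (p.map φ₁) = 0
  · have hdeg := derivative_eq_zero.1 hder0
    have hdeg₂ := (natDegree_map_eq_of_sign_eq hcp).symm.trans hdeg
    intro X
    obtain ⟨f, hf, hfs⟩ := h12 X
    refine ⟨f, hf, fun q hq x hx => ?_⟩
    rcases Finset.mem_insert.1 hq with rfl | hq
    · rw [eq_C_of_natDegree_eq_zero hdeg, eq_C_of_natDegree_eq_zero hdeg₂, eval_C, eval_C,
        coeff_map, coeff_map]
      exact hcp 0
    · exact hfs q (hAA' hq) x hx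
  exact insert_of_derivative_ne_zero hR₁ hR₂ hAA' hcoeff hlead hder hder0 hrem h12 h21

end SignMatchStep

section Determined

open Polynomial

variable {B : Type*} [CommRing B]

/-- The sign configurations realised by `P` over `R₁` and over `R₂` are the same as soon as
finitely many elements of the coefficient ring have the same signs in `R₁` and in `R₂`. -/
def Determined (R₁ R₂ : Type*) [Field R₁] [LinearOrder R₁] [Field R₂] [LinearOrder R₂]
    (P : Finset B[X]) : Prop :=
  ∃ S : Finset B, ∀ (φ₁ : B →+* R₁) (φ₂ : B →+* R₂),
    (∀ s ∈ S, SignType.sign (φ₁ s) = SignType.sign (φ₂ s)) →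
      SignMatch φ₁ φ₂ P ∧ SignMatch φ₂ φ₁ P

theorem exists_strictMonoOn_finset {R₁ R₂ : Type*} [LinearOrder R₁] [Field R₂] [LinearOrder R₂]
    [IsStrictOrderedRing R₂] (s : Finset R₁) : ∃ f : R₁ → R₂, StrictMonoOn f s := by
  refine ⟨fun x => ((s.filter (· < x)).card : R₂), fun x hx y _ hxy => ?_⟩
  rw [Nat.cast_lt]
  refine Finset.card_lt_card (Finset.ssubset_iff_of_subset (fun z hz => ?_) |>.2 ⟨x, ?_, ?_⟩)
  · simp only [Finset.mem_filter] at hz ⊢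
    exact ⟨hz.1, hz.2.trans hxy⟩
  · simpa using ⟨hx, hxy⟩
  · simp

variable {R₁ R₂ : Type*} [Field R₁] [LinearOrder R₁] [Field R₂] [LinearOrder R₂]

theorem Determined.mono {P Q : Finset B[X]} (hPQ : P ⊆ Q) (h : Determined R₁ R₂ Q) :
    Determined R₁ R₂ P := by
  obtain ⟨S, hS⟩ := h
  exact ⟨S, fun φ₁ φ₂ h => ⟨(hS φ₁ φ₂ h).1.mono hPQ, (hS φ₁ φ₂ h).2.mono hPQ⟩⟩

variable [IsStrictOrderedRing R₂]

theorem SignMatch.of_natDegree_eq_zero {φ₁ : B →+* R₁} {φ₂ : B →+* R₂} {P : Finset B[X]}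
    (hP : ∀ p ∈ P, p.natDegree = 0)
    (h : ∀ p ∈ P, SignType.sign (φ₁ (p.coeff 0)) = SignType.sign (φ₂ (p.coeff 0))) :
    SignMatch φ₁ φ₂ P := by
  intro s
  obtain ⟨f, hf⟩ := exists_strictMonoOn_finset (R₂ := R₂) s
  refine ⟨f, hf, fun p hp x _ => ?_⟩
  rw [eq_C_of_natDegree_eq_zero (hP p hp), map_C, map_C, eval_C, eval_C]
  exact h p hp

variable [IsStrictOrderedRing R₁]

open Classical in
theorem determined_of_natDegree_eq_zero {P : Finset B[X]} (hP : ∀ p ∈ P, p.natDegree = 0) :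
    Determined R₁ R₂ P := by
  refine ⟨P.image fun p => p.coeff 0, fun φ₁ φ₂ h => ?_⟩
  have h' : ∀ p ∈ P, SignType.sign (φ₁ (p.coeff 0)) = SignType.sign (φ₂ (p.coeff 0)) :=
    fun p hp => h _ (Finset.mem_image_of_mem _ hp)
  exact ⟨SignMatch.of_natDegree_eq_zero hP h',
    SignMatch.of_natDegree_eq_zero hP fun p hp => (h' p hp).symm⟩

open Classical in
theorem determined_insert (hR₁ : PolynomialIVT R₁) (hR₂ : PolynomialIVT R₂)
    {A A' : Finset B[X]} {p : B[X]} (hAA' : A ⊆ A')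
    (hder : derivative p ∈ A) (herase : p.eraseLead ∈ A')
    (hrem : ∀ q ∈ A, ∀ j, 0 < j → j ≤ q.natDegree →
      ∃ (k : ℕ) (h : B[X]), ∃ u ∈ A', C (q.coeff j) ^ (2 * k) * p = q.lowerPart j * h + u)
    (h : Determined R₁ R₂ A') : Determined R₁ R₂ (insert p A) := by
  obtain ⟨S, hS⟩ := h
  refine ⟨S ∪ (insert p A).biUnion fun q => (Finset.range (q.natDegree + 1)).image q.coeff,
    fun φ₁ φ₂ h => ?_⟩
  have hcoeff : ∀ q ∈ insert p A, ∀ i,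
      SignType.sign (φ₁ (q.coeff i)) = SignType.sign (φ₂ (q.coeff i)) := by
    intro q hq i
    rcases lt_or_ge q.natDegree i with hi | hi
    · rw [coeff_eq_zero_of_natDegree_lt hi, RingHom.map_zero, RingHom.map_zero, sign_zero, sign_zero]
    · exact h _ (Finset.mem_union_right _ (Finset.mem_biUnion.2
        ⟨q, hq, Finset.mem_image_of_mem _ (Finset.mem_range.2 (by omega))⟩))
  obtain ⟨h12, h21⟩ := hS φ₁ φ₂ fun s hs => h s (Finset.mem_union_left _ hs)
  exact ⟨SignMatch.insert hR₁ hR₂ hAA' hcoeff hder herase hrem h12 h21,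
    SignMatch.insert hR₂ hR₁ hAA' (fun q hq i => (hcoeff q hq i).symm) hder herase hrem h21 h12⟩

open Classical in
theorem determined_union (hR₁ : PolynomialIVT R₁) (hR₂ : PolynomialIVT R₂) {N : ℕ} (hN : 0 < N)
    (ih : ∀ L : Finset B[X], (∀ p ∈ L, p.natDegree < N) → Determined R₁ R₂ L)
    (T : Finset B[X]) (hT : ∀ p ∈ T, p.natDegree ≤ N) (L : Finset B[X])
    (hL : ∀ p ∈ L, p.natDegree < N) : Determined R₁ R₂ (L ∪ T) := by
  induction T using Finset.induction_on generalizing L with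
  | empty => simpa using ih L hL
  | insert p T _ ihT =>
    have hp : p.natDegree ≤ N := hT p (Finset.mem_insert_self _ _)
    have hT' : ∀ q ∈ T, q.natDegree ≤ N := fun q hq => hT q (Finset.mem_insert_of_mem hq)
    have hrem : ∀ (q : B[X]) (j : ℕ), ∃ u : B[X], 0 < j → u.natDegree < j ∧
        ∃ (k : ℕ) (h : B[X]), C (q.coeff j) ^ (2 * k) * p = q.lowerPart j * h + u := by
      intro q j
      by_cases hj : 0 < j
      · obtain ⟨k, h, u, hu, hd⟩ :=
          (q.lowerPart j).exists_pow_mul_eq_mul_add hj (natDegree_lowerPart_le q j) p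
        rw [coeff_lowerPart, if_pos le_rfl] at hu
        exact ⟨u, fun _ => ⟨hd, k, h, hu⟩⟩
      · exact ⟨0, fun h => absurd h hj⟩
    choose u hu using hrem
    set A := insert (derivative p) L ∪ T with hA
    set U := A.biUnion fun q => (Finset.Icc 1 q.natDegree).image (u q) with hU
    have hder : (derivative p).natDegree < N :=
      (natDegree_derivative_le p).trans_lt (by omega)
    have hAN : ∀ q ∈ A, q.natDegree ≤ N := by
      intro q hq
      simp only [hA, Finset.mem_union, Finset.mem_insert] at hq
      rcases hq with (rfl | hq) | hq
      · exact hder.le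
      · exact (hL q hq).le
      · exact hT' q hq
    have hL' : ∀ q ∈ insert p.eraseLead (insert (derivative p) L ∪ U), q.natDegree < N := by
      intro q hq
      simp only [Finset.mem_union, Finset.mem_insert] at hq
      rcases hq with rfl | (rfl | hq) | hq
      · exact (eraseLead_natDegree_le p).trans_lt (by omega)
      · exact hder
      · exact hL q hq
      · obtain ⟨r, hr, hq⟩ := Finset.mem_biUnion.1 hq
        obtain ⟨j, hj, rfl⟩ := Finset.mem_image.1 hq
        rw [Finset.mem_Icc] at hj
        exact (hu r j hj.1).1.trans_le (hj.2.trans (hAN r hr))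
    refine (determined_insert hR₁ hR₂ (A := A) (p := p) ?_ ?_ ?_ ?_ (ihT hT' _ hL')).mono ?_
    · intro q hq
      simp only [hA, Finset.mem_union, Finset.mem_insert] at hq ⊢
      tauto
    · simp [hA]
    · simp
    · intro q hq j hj hjq
      obtain ⟨k, h, hk⟩ := (hu q j hj).2
      refine ⟨k, h, u q j, ?_, hk⟩
      have : u q j ∈ U := Finset.mem_biUnion.2
        ⟨q, hq, Finset.mem_image_of_mem _ (Finset.mem_Icc.2 ⟨hj, hjq⟩)⟩
      simp [this]
    · intro q hq
      simp only [hA, Finset.mem_union, Finset.mem_insert] at hq ⊢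
      tauto

theorem determined_of_natDegree_lt (hR₁ : PolynomialIVT R₁) (hR₂ : PolynomialIVT R₂) (N : ℕ)
    (P : Finset B[X]) (hP : ∀ p ∈ P, p.natDegree < N + 1) : Determined R₁ R₂ P := by
  classical
  induction N generalizing P with
  | zero => exact determined_of_natDegree_eq_zero fun p hp => by have := hP p hp; omega
  | succ N ih =>
    simpa using determined_union hR₁ hR₂ N.succ_pos ih P
      (fun p hp => by have := hP p hp; omega) ∅ (by simp)

/-- Sign configurations of univariate polynomials transfer between ordered fields with the
intermediate value property. -/
theorem determined (hR₁ : PolynomialIVT R₁) (hR₂ : PolynomialIVT R₂) (P : Finset B[X]) :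
    Determined R₁ R₂ P :=
  determined_of_natDegree_lt hR₁ hR₂ (P.sup natDegree) P fun _ hp =>
    Nat.lt_succ_of_le (Finset.le_sup hp)

end Determined

section Transfer

theorem MvPolynomial.eval₂_cons_eq_eval_map_finSuccEquiv {K R : Type*} [CommRing K] [CommRing R]
    (ι : K →+* R) {n : ℕ} (x : Fin n → R) (a : R) (p : MvPolynomial (Fin (n + 1)) K) :
    p.eval₂ ι (Fin.cons a x : Fin (n + 1) → R) =
      ((finSuccEquiv K n p).map (eval₂Hom ι x)).eval a := by
  have h : eval₂Hom ι (Fin.cons a x : Fin (n + 1) → R) =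
      ((Polynomial.evalRingHom a).comp (Polynomial.mapRingHom (eval₂Hom ι x))).comp
        (finSuccEquiv K n : MvPolynomial (Fin (n + 1)) K →+* _) := by
    refine ringHom_ext (fun r => ?_) fun i => ?_
    · simp [finSuccEquiv_apply]
    · refine Fin.cases ?_ (fun j => ?_) i <;> simp [finSuccEquiv_apply]
  exact DFunLike.congr_fun h p

/-- Sign conditions satisfied at a point over `R` are satisfied at a point over `K`. -/
theorem PolynomialIVT.exists_sign_eval_eq {K R : Type*} [Field K] [LinearOrder K]
    [IsStrictOrderedRing K] [Field R] [LinearOrder R] [IsStrictOrderedRing R]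
    (hK : PolynomialIVT K) (hR : PolynomialIVT R) (ι : K →+* R)
    (hι : ∀ a, SignType.sign (ι a) = SignType.sign a) {n : ℕ}
    (P : Finset (MvPolynomial (Fin n) K)) (x : Fin n → R) :
    ∃ y : Fin n → K, ∀ p ∈ P,
      SignType.sign (p.eval₂ ι x) = SignType.sign (MvPolynomial.eval y p) := by
  classical
  induction n with
  | zero =>
    refine ⟨fun i => i.elim0, fun p _ => ?_⟩
    rw [MvPolynomial.eq_C_of_isEmpty p, MvPolynomial.eval₂_C, MvPolynomial.eval_C, hι]
  | succ n ih =>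
    obtain ⟨S, hS⟩ := determined hR hK (P.image (MvPolynomial.finSuccEquiv K n))
    obtain ⟨y, hy⟩ := ih S (Fin.tail x)
    obtain ⟨f, -, hf⟩ := (hS (MvPolynomial.eval₂Hom ι (Fin.tail x)) (MvPolynomial.eval y) hy).1 {x 0}
    refine ⟨Fin.cons (f (x 0)) y, fun p hp => ?_⟩
    rw [MvPolynomial.eval_eq_eval_mv_eval', ← Fin.cons_self_tail x,
      MvPolynomial.eval₂_cons_eq_eval_map_finSuccEquiv]
    exact hf _ (Finset.mem_image_of_mem _ hp) _ (Finset.mem_singleton_self _)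

end Transfer

section RealClosure

open Polynomial

theorem IsSumSq.map_ringHom {A B : Type*} [CommRing A] [CommRing B] (f : A →+* B) {s : A}
    (hs : IsSumSq s) : IsSumSq (f s) := by
  induction hs with
  | zero => rw [map_zero]; exact .zero
  | sq_add a _ ih => rw [map_add, map_mul]; exact .sq_add _ ih

theorem IsSemireal.of_ringHom {A B : Type*} [CommRing A] [CommRing B] (f : A →+* B)
    [IsSemireal B] : IsSemireal A :=
  .of_not_isSumSq_neg_one fun h => IsSemireal.not_isSumSq_neg_one B <| by
    simpa using h.map_ringHom f

theorem IsSemireal.eq_zero_of_isSumSq_neg {F : Type*} [Field F] [IsSemireal F] {a : F}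
    (h : IsSumSq a) (h' : IsSumSq (-a)) : a = 0 := by
  by_contra ha
  refine IsSemireal.not_isSumSq_neg_one F ?_
  have : (-1 : F) = a * -a * (a⁻¹ * a⁻¹) := by field_simp
  rw [this]
  exact (h.mul h').mul (.mul_self _)

/-- A semireal field in which every irreducible polynomial defining a semireal extension has
a root. -/
def IsMaximalSemireal (R : Type*) [Field R] : Prop :=
  IsSemireal R ∧ ∀ g : R[X], Irreducible g → IsSemireal (AdjoinRoot g) → ∃ r, g.eval r = 0

theorem Subfield.exists_isSumSq_of_mem_sSup {Ω : Type*} [Field Ω] {c : Set (Subfield Ω)}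
    (hne : c.Nonempty) (hc : DirectedOn (· ≤ ·) c) {s : ↥(sSup c)} (hs : IsSumSq s) :
    ∃ K ∈ c, ∃ t : K, IsSumSq t ∧ (t : Ω) = s := by
  induction hs with
  | zero =>
    obtain ⟨K, hK⟩ := hne
    exact ⟨K, hK, 0, .zero, rfl⟩
  | sq_add a _ ih =>
    obtain ⟨K, hK, t, ht, hts⟩ := ih
    obtain ⟨K', hK', ha⟩ := (Subfield.mem_sSup_of_directedOn hne hc).1 a.2
    obtain ⟨L, hL, hKL, hKL'⟩ := hc K hK K' hK'
    refine ⟨L, hL, _, .sq_add ⟨a, hKL' ha⟩ (ht.map_ringHom (Subfield.inclusion hKL)), ?_⟩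
    simp [← hts]
    rfl

theorem exists_maximal_semireal (F : Type*) [Field F] [IsSemireal F] :
    ∃ M : Subfield (AlgebraicClosure F), (algebraMap F (AlgebraicClosure F)).fieldRange ≤ M ∧
      Maximal (fun K : Subfield (AlgebraicClosure F) => IsSemireal K) M := by
  refine zorn_le_nonempty₀ {K : Subfield (AlgebraicClosure F) | IsSemireal K} ?_ _ ?_
  · intro c hc hchain K hK
    refine ⟨sSup c, .of_not_isSumSq_neg_one fun h => ?_, fun z hz => le_sSup hz⟩
    obtain ⟨L, hL, t, ht, hts⟩ := Subfield.exists_isSumSq_of_mem_sSup ⟨K, hK⟩ hchain.directedOn h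
    have : IsSemireal L := hc hL
    refine IsSemireal.not_isSumSq_neg_one L ?_
    have htm : t = -1 := Subtype.ext (hts.trans (by simp))
    rwa [htm] at ht
  · exact IsSemireal.of_ringHom
      (RingEquiv.ofBijective (algebraMap F (AlgebraicClosure F)).rangeRestrictField
        ⟨RingHom.injective _, fun ⟨x, y, hy⟩ => ⟨y, Subtype.ext hy⟩⟩).symm.toRingHom

theorem isMaximalSemireal_of_maximal {Ω : Type*} [Field Ω] [IsAlgClosed Ω] {M : Subfield Ω}
    (hM : Maximal (fun K : Subfield Ω => IsSemireal K) M) : IsMaximalSemireal M := by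
  refine ⟨hM.prop, fun g hg hsg => ?_⟩
  have : Fact (Irreducible g) := ⟨hg⟩
  obtain ⟨α, hα⟩ := IsAlgClosed.exists_eval₂_eq_zero M.subtype g (degree_pos_of_irreducible hg).ne'
  set f : AdjoinRoot g →+* Ω := AdjoinRoot.lift M.subtype α hα with hf
  have hrange : IsSemireal f.fieldRange := IsSemireal.of_ringHom
      (RingEquiv.ofBijective f.rangeRestrictField
        ⟨RingHom.injective _, fun ⟨x, y, hy⟩ => ⟨y, Subtype.ext hy⟩⟩).symm.toRingHom
  have hle : M ≤ f.fieldRange := fun x hx =>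
    ⟨AdjoinRoot.of g ⟨x, hx⟩, by rw [hf, AdjoinRoot.lift_of]; rfl⟩
  have hαM : α ∈ M := hM.le_of_ge hrange hle ⟨AdjoinRoot.root g, by rw [hf, AdjoinRoot.lift_root]⟩
  refine ⟨⟨α, hαM⟩, M.subtype_injective ?_⟩
  rw [map_zero, ← hα, ← eval₂_at_apply]
  rfl

theorem exists_isMaximalSemireal (F : Type*) [Field F] [IsSemireal F] :
    ∃ M : Subfield (AlgebraicClosure F), IsMaximalSemireal M ∧ Nonempty (F →+* M) := by
  obtain ⟨M, hFM, hM⟩ := exists_maximal_semireal F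
  exact ⟨M, isMaximalSemireal_of_maximal hM,
    ⟨(algebraMap F (AlgebraicClosure F)).codRestrict M fun x => hFM ⟨x, rfl⟩⟩⟩

variable {R : Type*} [Field R]

/-- Sums of squares in `R[X] / (g)` lift to sums of squares of low degree. -/
theorem AdjoinRoot.exists_isSumSq_mk_eq {g : R[X]} (hg : 0 < g.natDegree) {s : AdjoinRoot g}
    (hs : IsSumSq s) : ∃ p : R[X], AdjoinRoot.mk g p = s ∧ IsSumSq p ∧
      p.natDegree ≤ (g.natDegree - 1) + (g.natDegree - 1) ∧
      IsSumSq (p.coeff ((g.natDegree - 1) + (g.natDegree - 1))) := by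
  induction hs with
  | zero => exact ⟨0, map_zero _, .zero, by simp, by simp⟩
  | sq_add a _ ih =>
    obtain ⟨p, hp, hpS, hpd, hpc⟩ := ih
    obtain ⟨h, rfl⟩ := AdjoinRoot.mk_surjective a
    have hd : (h % g).natDegree ≤ g.natDegree - 1 := by
      have := natDegree_mod_lt h hg.ne'
      omega
    refine ⟨h % g * (h % g) + p, ?_, .sq_add _ hpS, ?_, ?_⟩
    · have : AdjoinRoot.mk g (h % g) = AdjoinRoot.mk g h := by
        rw [AdjoinRoot.mk_eq_mk, EuclideanDomain.mod_eq_sub_mul_div]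
        exact ⟨-(h / g), by ring⟩
      rw [map_add, map_mul, this, hp]
    · exact (natDegree_add_le _ _).trans (max_le (natDegree_mul_le_of_le hd hd) hpd)
    · rw [coeff_add, coeff_mul_add_eq_of_natDegree_le hd hd]
      exact .sq_add _ hpc

theorem IsMaximalSemireal.isSumSq_or_isSumSq_neg (hR : IsMaximalSemireal R) (a : R) :
    IsSumSq a ∨ IsSumSq (-a) := by
  have := hR.1
  by_cases ha : ∀ b : R, b ^ 2 ≠ a
  swap
  · push Not at ha
    obtain ⟨b, rfl⟩ := ha
    exact .inl (by simp [sq])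
  right
  have hirr := X_pow_sub_C_irreducible_of_prime Nat.prime_two ha
  have hdeg : (X ^ 2 - C a : R[X]).natDegree = 2 := natDegree_X_pow_sub_C
  have hns : ¬ IsSemireal (AdjoinRoot (X ^ 2 - C a)) := fun h => by
    obtain ⟨r, hr⟩ := hR.2 _ hirr h
    exact ha r (by simpa [sub_eq_zero] using hr)
  rw [isSemireal_iff_not_isSumSq_neg_one, not_not] at hns
  obtain ⟨p, hp, hpS, hpd, hpc⟩ := AdjoinRoot.exists_isSumSq_mk_eq (by omega) hns
  rw [hdeg] at hpd hpc
  norm_num at hpd hpc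
  have hdvd : X ^ 2 - C a ∣ p + 1 := by
    rw [← AdjoinRoot.mk_eq_zero, map_add, hp, map_one, neg_add_cancel]
  have hz : p + 1 - C (p.coeff 2) * (X ^ 2 - C a) = 0 := by
    refine eq_zero_of_dvd_of_natDegree_lt (hdvd.sub (dvd_mul_left _ _)) ?_
    rw [hdeg, Nat.lt_succ_iff, natDegree_le_iff_coeff_eq_zero]
    intro N hN
    obtain rfl | hN := (show 2 ≤ N by omega).eq_or_lt
    · simp [coeff_one]
    · rw [coeff_sub, coeff_add, coeff_eq_zero_of_natDegree_lt (by omega : p.natDegree < N),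
        coeff_C_mul, coeff_sub, coeff_X_pow, coeff_C, coeff_one, if_neg (by omega),
        if_neg (by omega), if_neg (by omega)]
      ring
  have h0 : IsSumSq (p.coeff 0) := by
    rw [coeff_zero_eq_eval_zero]
    exact hpS.map_ringHom (evalRingHom 0)
  have heq : p.coeff 0 + 1 = p.coeff 2 * -a := by
    have := congrArg (coeff · 0) hz
    simp at this
    linear_combination this
  have hne : p.coeff 2 ≠ 0 := fun h => by
    rw [h, zero_mul, add_comm] at heq
    exact IsSemireal.one_add_ne_zero h0 heq
  have : -a = (p.coeff 0 + 1) * p.coeff 2 * ((p.coeff 2)⁻¹ * (p.coeff 2)⁻¹) := by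
    rw [heq]
    field_simp
  rw [this]
  exact ((h0.add .one).mul hpc).mul (.mul_self _)

/-- The cone of sums of squares. -/
def IsMaximalSemireal.cone (hR : IsMaximalSemireal R) : RingCone R where
  __ := Subsemiring.sumSq R
  eq_zero_of_mem_of_neg_mem' {a} h h' :=
    have := hR.1
    IsSemireal.eq_zero_of_isSumSq_neg (a := a) (by simpa using h) (by simpa using h')

theorem IsMaximalSemireal.exists_linearOrder (hR : IsMaximalSemireal R) :
    ∃ _ : LinearOrder R, IsStrictOrderedRing R := by
  classical
  have : HasMemOrNegMem hR.cone :=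
    ⟨fun a => by simpa [IsMaximalSemireal.cone] using hR.isSumSq_or_isSumSq_neg a⟩
  let _ : LinearOrder R := .mkOfAddGroupCone hR.cone
  have : IsOrderedRing R := .mkOfCone hR.cone
  exact ⟨inferInstance, inferInstance⟩

variable [LinearOrder R] [IsStrictOrderedRing R]

theorem IsMaximalSemireal.polynomialIVT (hR : IsMaximalSemireal R) : PolynomialIVT R := by
  intro f
  induction hd : f.natDegree using Nat.strong_induction_on generalizing f with
  | _ d ih =>
    intro a b hab hneg
    have hf0 : f ≠ 0 := by
      rintro rfl
      simp at hneg
    have hfu : ¬ IsUnit f := by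
      intro hu
      obtain ⟨c, -, rfl⟩ := isUnit_iff.1 hu
      simp only [eval_C] at hneg
      exact hneg.not_ge (mul_self_nonneg c)
    by_cases hirr : Irreducible f
    · by_cases hs : IsSemireal (AdjoinRoot f)
      · obtain ⟨r, hr⟩ := hR.2 f hirr hs
        have hdeg := degree_eq_one_of_irreducible_of_root hirr hr
        have hev : ∀ x, f.eval x = f.coeff 1 * (x - r) := by
          intro x
          have hx := eq_X_add_C_of_degree_le_one hdeg.le
          have hrx := congrArg (eval r) hx
          rw [hr] at hrx
          conv_lhs => rw [hx]
          simp at hrx ⊢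
          linear_combination -hrx
        rw [hev, hev] at hneg
        have hprod : (a - r) * (b - r) < 0 := by
          by_contra! h
          nlinarith [mul_nonneg (sq_nonneg (f.coeff 1)) h]
        rcases mul_neg_iff.1 hprod with h | h
        · linarith
        · exact ⟨r, ⟨by linarith, by linarith⟩, hr⟩
      · rw [isSemireal_iff_not_isSumSq_neg_one, not_not] at hs
        have hfd : 0 < f.natDegree := hirr.natDegree_pos
        obtain ⟨p, hp, hpS, hpd, -⟩ := AdjoinRoot.exists_isSumSq_mk_eq hfd hs
        have hpos : ∀ x, 0 < p.eval x + 1 := fun x =>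
          add_pos_of_nonneg_of_pos (hpS.map_ringHom (evalRingHom x)).nonneg one_pos
        obtain ⟨k, hk⟩ : f ∣ p + 1 := by
          rw [← AdjoinRoot.mk_eq_zero, map_add, hp, map_one, neg_add_cancel]
        have hev : ∀ x, p.eval x + 1 = f.eval x * k.eval x := fun x => by
          rw [← eval_mul, ← hk, eval_add, eval_one]
        have hk0 : k ≠ 0 := by
          rintro rfl
          have := hpos a
          rw [hev] at this
          simp at this
        have hkd : k.natDegree < d := by
          have h1 := natDegree_mul hf0 hk0
          have h2 : (p + 1).natDegree ≤ max p.natDegree 0 := by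
            simpa using natDegree_add_le p 1
          rw [← hk] at h1
          simp at h2
          omega
        have hk_neg : k.eval a * k.eval b < 0 := by
          have ha := hpos a
          have hb := hpos b
          rw [hev] at ha hb
          by_contra! h
          nlinarith [mul_pos ha hb, mul_nonneg_of_nonpos_of_nonpos hneg.le (neg_nonpos.2 h)]
        obtain ⟨c, -, hc⟩ := ih _ hkd k rfl a b hab hk_neg
        have := hpos c
        rw [hev, hc, mul_zero] at this
        exact absurd this (lt_irrefl _)
    · obtain ⟨u, v, hu, hv, rfl⟩ : ∃ u v : R[X], ¬ IsUnit u ∧ ¬ IsUnit v ∧ f = u * v := by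
        by_contra! h
        exact hirr ⟨hfu, fun u v huv => by
          by_contra! h'
          exact h u v h'.1 h'.2 huv⟩
      have hu0 := left_ne_zero_of_mul hf0
      have hv0 := right_ne_zero_of_mul hf0
      have hdeg := natDegree_mul hu0 hv0
      have hud : 0 < u.natDegree :=
        natDegree_pos_iff_degree_pos.2 (degree_pos_of_ne_zero_of_nonunit hu0 hu)
      have hvd : 0 < v.natDegree :=
        natDegree_pos_iff_degree_pos.2 (degree_pos_of_ne_zero_of_nonunit hv0 hv)
      rw [eval_mul, eval_mul, mul_mul_mul_comm] at hneg
      rcases mul_neg_iff.1 hneg with h | h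
      · obtain ⟨c, hc, hc0⟩ := ih _ (by omega) v rfl a b hab h.2
        exact ⟨c, hc, by rw [eval_mul, hc0, mul_zero]⟩
      · obtain ⟨c, hc, hc0⟩ := ih _ (by omega) u rfl a b hab h.1
        exact ⟨c, hc, by rw [eval_mul, hc0, zero_mul]⟩

end RealClosure

section RealIdeal

variable {A : Type*} [CommRing A]

/-- An ideal containing every element whose square occurs in a sum of squares in the ideal. -/
def Ideal.IsReal (I : Ideal A) : Prop :=
  ∀ a s : A, IsSumSq s → a * a + s ∈ I → a ∈ I

theorem Ideal.IsReal.comap_mul {I : Ideal A} (hI : I.IsReal) (a : A) :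
    Ideal.IsReal (Submodule.comap (LinearMap.lsmul A A a) I) := by
  intro x s hs h
  refine hI (a * x) (a * a * s) ((IsSumSq.mul_self a).mul hs) ?_
  have : a * x * (a * x) + a * a * s = a * (a * (x * x + s)) := by ring
  rw [this]
  exact I.mul_mem_left a h

theorem Ideal.isPrime_of_maximal_isReal {Q : Ideal A} {f : A}
    (hQ : Maximal (fun I : Ideal A => I.IsReal ∧ f ∉ I) Q) : Q.IsPrime := by
  have hcolon : ∀ a, f ∉ Submodule.comap (LinearMap.lsmul A A a) Q →
      Submodule.comap (LinearMap.lsmul A A a) Q ≤ Q := fun a ha =>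
    hQ.le_of_ge ⟨hQ.prop.1.comap_mul a, ha⟩ fun x hx => Q.mul_mem_left a hx
  refine ⟨fun h => hQ.prop.2 (h ▸ Submodule.mem_top), fun {a b} hab => ?_⟩
  by_cases hfa : f ∈ Submodule.comap (LinearMap.lsmul A A a) Q
  · left
    refine hcolon f (fun hf => hQ.prop.2 ?_) ?_
    · exact hQ.prop.1 f 0 .zero (by simpa using hf)
    · simpa [mul_comm] using hfa
  · exact .inr (hcolon a hfa hab)

theorem Ideal.IsReal.exists_isPrime {I : Ideal A} (hI : I.IsReal) {f : A} (hf : f ∉ I) :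
    ∃ Q : Ideal A, I ≤ Q ∧ Q.IsPrime ∧ Q.IsReal ∧ f ∉ Q := by
  obtain ⟨Q, hIQ, hQ⟩ := zorn_le_nonempty₀ {Q : Ideal A | Q.IsReal ∧ f ∉ Q} (fun c hc hch K hK => by
    have hmem : ∀ x, x ∈ sSup c ↔ ∃ L ∈ c, x ∈ L := fun x =>
      Submodule.mem_sSup_of_directed ⟨K, hK⟩ hch.directedOn
    refine ⟨sSup c, ⟨fun a s hs h => ?_, fun h => ?_⟩, fun z hz => le_sSup hz⟩
    · obtain ⟨L, hL, hmL⟩ := (hmem _).1 h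
      exact (hmem a).2 ⟨L, hL, (hc hL).1 a s hs hmL⟩
    · obtain ⟨L, hL, hmL⟩ := (hmem _).1 h
      exact (hc hL).2 hmL) I ⟨hI, hf⟩
  exact ⟨Q, hIQ, isPrime_of_maximal_isReal hQ, hQ.prop.1, hQ.prop.2⟩

theorem IsSumSq.exists_map_eq {B : Type*} [CommRing B] {g : A →+* B} (hg : Function.Surjective g)
    {t : B} (ht : IsSumSq t) : ∃ s, IsSumSq s ∧ g s = t := by
  induction ht with
  | zero => exact ⟨0, .zero, map_zero g⟩
  | sq_add b _ ih =>
    obtain ⟨s, hs, rfl⟩ := ih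
    obtain ⟨a, rfl⟩ := hg b
    exact ⟨a * a + s, .sq_add a hs, by rw [map_add, map_mul]⟩

theorem IsSumSq.exists_mul_eq_algebraMap {D F : Type*} [CommRing D] [IsDomain D] [Field F]
    [Algebra D F] [IsFractionRing D F] {s : F} (hs : IsSumSq s) :
    ∃ d t : D, d ≠ 0 ∧ IsSumSq t ∧ s * algebraMap D F (d * d) = algebraMap D F t := by
  induction hs with
  | zero => exact ⟨1, 0, one_ne_zero, .zero, by simp⟩
  | sq_add a _ ih =>
    obtain ⟨d, t, hd, ht, h⟩ := ih
    obtain ⟨p, m, hm, rfl⟩ := IsFractionRing.div_surjective (A := D) a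
    have hm0 : m ≠ 0 := nonZeroDivisors.ne_zero hm
    have hm1 : algebraMap D F m ≠ 0 := by simpa using hm0
    refine ⟨d * m, p * d * (p * d) + t * (m * m), mul_ne_zero hd hm0,
      .sq_add _ (ht.mul (.mul_self m)), ?_⟩
    simp only [map_mul, map_add] at h ⊢
    rw [← h]
    field_simp

theorem Ideal.IsReal.isSemireal_fractionRing {Q : Ideal A} [Q.IsPrime] (hQ : Q.IsReal) :
    IsSemireal (FractionRing (A ⧸ Q)) := by
  refine .of_not_isSumSq_neg_one fun h => ?_
  obtain ⟨d, t, hd, ht, h⟩ := h.exists_mul_eq_algebraMap (D := A ⧸ Q)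
  obtain ⟨s, hs, rfl⟩ := ht.exists_map_eq Ideal.Quotient.mk_surjective
  obtain ⟨a, rfl⟩ := Ideal.Quotient.mk_surjective d
  refine hd (Ideal.Quotient.eq_zero_iff_mem.2 (hQ a s hs ?_))
  rw [← Ideal.Quotient.eq_zero_iff_mem, map_add, map_mul,
    ← (IsFractionRing.injective (A ⧸ Q) (FractionRing (A ⧸ Q))).eq_iff, map_add, ← h, map_zero]
  ring

theorem sign_ringHom_real {R : Type*} [Field R] [LinearOrder R] [IsStrictOrderedRing R]
    (ι : ℝ →+* R) (a : ℝ) : SignType.sign (ι a) = SignType.sign a := by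
  have hpos : ∀ b : ℝ, 0 < b → 0 < ι b := fun b hb => by
    rw [← Real.mul_self_sqrt hb.le, map_mul]
    exact mul_self_pos.2 (by simpa using (Real.sqrt_pos.2 hb).ne')
  rcases lt_trichotomy a 0 with h | rfl | h
  · rw [sign_neg h, sign_neg]
    simpa using hpos (-a) (by linarith)
  · rw [RingHom.map_zero, sign_zero, sign_zero]
  · rw [sign_pos h, sign_pos (hpos a h)]

/-- The real Nullstellensatz for real ideals of `ℝ[X₁, …, Xₙ]`. -/
theorem Ideal.IsReal.exists_eval_ne_zero {n : ℕ} {J : Ideal (MvPolynomial (Fin n) ℝ)}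
    (hJ : J.IsReal) {f : MvPolynomial (Fin n) ℝ} (hf : f ∉ J) :
    ∃ y : Fin n → ℝ, (∀ p ∈ J, MvPolynomial.eval y p = 0) ∧ MvPolynomial.eval y f ≠ 0 := by
  classical
  obtain ⟨Q, hJQ, hprime, hQ, hfQ⟩ := hJ.exists_isPrime hf
  have := hQ.isSemireal_fractionRing
  obtain ⟨M, hM, ⟨φ⟩⟩ := exists_isMaximalSemireal (FractionRing (MvPolynomial (Fin n) ℝ ⧸ Q))
  obtain ⟨_, _⟩ := hM.exists_linearOrder
  set ψ : MvPolynomial (Fin n) ℝ →+* M :=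
    (φ.comp (algebraMap _ _)).comp (Ideal.Quotient.mk Q) with hψ
  have hψ0 : ∀ p, ψ p = 0 ↔ p ∈ Q := fun p => by
    rw [← Ideal.Quotient.eq_zero_iff_mem, hψ, RingHom.comp_apply, RingHom.comp_apply, map_eq_zero,
      map_eq_zero_iff _ (IsFractionRing.injective _ _)]
  have hψe : ∀ p, p.eval₂ (ψ.comp MvPolynomial.C) (fun i => ψ (MvPolynomial.X i)) = ψ p := fun p =>
    DFunLike.congr_fun (MvPolynomial.ringHom_ext (f := MvPolynomial.eval₂Hom (ψ.comp MvPolynomial.C)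
      fun i => ψ (MvPolynomial.X i)) (g := ψ) (by simp) (by simp)) p
  obtain ⟨G, hG⟩ := IsNoetherian.noetherian J
  obtain ⟨y, hy⟩ := polynomialIVT_real.exists_sign_eval_eq hM.polynomialIVT
    (ψ.comp MvPolynomial.C) (sign_ringHom_real _) (insert f G) fun i => ψ (MvPolynomial.X i)
  simp only [hψe] at hy
  have hker : J ≤ RingHom.ker (MvPolynomial.eval y) := by
    rw [← hG, Ideal.span_le]
    intro p hp
    have hpJ : p ∈ J := hG ▸ Ideal.subset_span hp
    have := hy p (Finset.mem_insert_of_mem hp)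
    rw [(hψ0 p).2 (hJQ hpJ), sign_zero, eq_comm, sign_eq_zero_iff] at this
    exact this
  refine ⟨y, fun p hp => hker hp, ?_⟩
  rw [← sign_ne_zero, ← hy f (Finset.mem_insert_self _ _), sign_ne_zero, Ne, hψ0]
  exact hfQ

end RealIdeal

section StarReal

open MvPolynomial

variable {n : ℕ}

theorem IsSumSq.exists_fin_sum {A : Type*} [CommRing A] {s : A} (hs : IsSumSq s) :
    ∃ (m : ℕ) (Q : Fin m → A), s = ∑ i, Q i * Q i := by
  induction hs with
  | zero => exact ⟨0, Fin.elim0, by simp⟩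
  | sq_add a _ ih =>
    obtain ⟨m, Q, rfl⟩ := ih
    exact ⟨m + 1, Fin.cons a Q, by simp [Fin.sum_univ_succ]⟩

theorem exists_eq_map_add_map (P : MvPolynomial (Fin n) ℂ) :
    ∃ A B : MvPolynomial (Fin n) ℝ,
      P = map Complex.ofRealHom A + C Complex.I * map Complex.ofRealHom B := by
  induction P using MvPolynomial.induction_on with
  | C a =>
    refine ⟨C a.re, C a.im, ?_⟩
    rw [map_C, map_C, ← C_mul, ← C_add, mul_comm]
    exact congrArg C (Complex.re_add_im a).symm
  | add p q hp hq =>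
    obtain ⟨A, B, rfl⟩ := hp
    obtain ⟨A', B', rfl⟩ := hq
    exact ⟨A + A', B + B', by simp only [map_add]; ring⟩
  | mul_X p i hp =>
    obtain ⟨A, B, rfl⟩ := hp
    exact ⟨A * X i, B * X i, by simp only [map_mul, map_X]; ring⟩

theorem starC_map_ofReal (A : MvPolynomial (Fin n) ℝ) :
    starC (map Complex.ofRealHom A) = map Complex.ofRealHom A := by
  rw [starC, map_map]
  congr 2
  ext
  simp

theorem starC_map_add_map (A B : MvPolynomial (Fin n) ℝ) :
    starC (map Complex.ofRealHom A + C Complex.I * map Complex.ofRealHom B) =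
      map Complex.ofRealHom A - C Complex.I * map Complex.ofRealHom B := by
  have hA := starC_map_ofReal A
  have hB := starC_map_ofReal B
  rw [starC] at hA hB ⊢
  rw [map_add, map_mul, hA, hB, map_C, Complex.conj_I, C_neg]
  ring

theorem evalC_map_ofReal (A : MvPolynomial (Fin n) ℝ) (x : Fin n → ℝ) :
    evalC (map Complex.ofRealHom A) x = (eval x A : ℝ) := by
  induction A using MvPolynomial.induction_on with
  | C a => simp [evalC]
  | add p q hp hq => simp_all [evalC]
  | mul_X p i hp => simp_all [evalC]

theorem evalC_starC (P : MvPolynomial (Fin n) ℂ) (x : Fin n → ℝ) :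
    evalC (starC P) x = starRingEnd ℂ (evalC P x) := by
  induction P using MvPolynomial.induction_on with
  | C a => simp [evalC, starC]
  | add p q hp hq => simp_all [evalC, starC]
  | mul_X p i hp => simp_all [evalC, starC]

theorem evalC_map_add_map_eq_zero_iff (A B : MvPolynomial (Fin n) ℝ) (x : Fin n → ℝ) :
    evalC (map Complex.ofRealHom A + C Complex.I * map Complex.ofRealHom B) x = 0 ↔
      eval x A = 0 ∧ eval x B = 0 := by
  have hA := evalC_map_ofReal A x
  have hB := evalC_map_ofReal B x
  rw [evalC] at hA hB ⊢
  rw [map_add, map_mul, hA, hB, aeval_C, Complex.ext_iff]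
  simp

theorem map_add_map_mem_iff {K : Ideal (MvPolynomial (Fin n) ℂ)}
    (hstar : ∀ P ∈ K, starC P ∈ K) (A B : MvPolynomial (Fin n) ℝ) :
    map Complex.ofRealHom A + C Complex.I * map Complex.ofRealHom B ∈ K ↔
      map Complex.ofRealHom A ∈ K ∧ map Complex.ofRealHom B ∈ K := by
  refine ⟨fun h => ?_, fun h => K.add_mem h.1 (K.mul_mem_left _ h.2)⟩
  have h' := hstar _ h
  rw [starC_map_add_map] at h'
  have h2 : (C 2⁻¹ * 2 : MvPolynomial (Fin n) ℂ) = 1 := by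
    rw [← map_ofNat C 2, ← C_mul]; simp
  have hI : (C Complex.I * C Complex.I : MvPolynomial (Fin n) ℂ) = -1 := by
    rw [← C_mul]; simp
  constructor
  · convert K.mul_mem_left (C 2⁻¹) (K.add_mem h h') using 1
    linear_combination -h2 * map Complex.ofRealHom A
  · convert K.mul_mem_left (-(C 2⁻¹ * C Complex.I)) (K.sub_mem h h') using 1
    linear_combination (C 2⁻¹ * 2 * map Complex.ofRealHom B) * hI - h2 * map Complex.ofRealHom B

theorem isReal_comap_ofReal {K : Ideal (MvPolynomial (Fin n) ℂ)}
    (hK : ∀ (s : ℕ) (Q : Fin s → MvPolynomial (Fin n) ℂ),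
      (∑ i, starC (Q i) * Q i) ∈ K → ∀ i, Q i ∈ K) :
    (K.comap (map (σ := Fin n) Complex.ofRealHom)).IsReal := by
  intro a s hs h
  obtain ⟨m, Q, rfl⟩ := hs.exists_fin_sum
  refine hK (m + 1) (fun i => map Complex.ofRealHom ((Fin.cons a Q : Fin (m + 1) → _) i)) ?_ 0
  simpa [Fin.sum_univ_succ, starC_map_ofReal] using h

theorem vanishingIdealC_le_of_isReal {I K : Ideal (MvPolynomial (Fin n) ℂ)}
    (hstar : ∀ P ∈ K, starC P ∈ K)
    (hK : ∀ (s : ℕ) (Q : Fin s → MvPolynomial (Fin n) ℂ),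
      (∑ i, starC (Q i) * Q i) ∈ K → ∀ i, Q i ∈ K) (hIK : I ≤ K) :
    vanishingIdealC (zeroSetC I) ≤ K := by
  intro P hP
  obtain ⟨A, B, rfl⟩ := exists_eq_map_add_map P
  have hzero : ∀ y : Fin n → ℝ,
      (∀ p ∈ K.comap (map (σ := Fin n) Complex.ofRealHom), eval y p = 0) →
        eval y A = 0 ∧ eval y B = 0 := by
    refine fun y hy => (evalC_map_add_map_eq_zero_iff A B y).1 (hP y fun p hp => ?_)
    obtain ⟨A', B', rfl⟩ := exists_eq_map_add_map p
    have h := (map_add_map_mem_iff hstar A' B').1 (hIK hp)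
    exact (evalC_map_add_map_eq_zero_iff A' B' y).2 ⟨hy A' h.1, hy B' h.2⟩
  refine (map_add_map_mem_iff hstar A B).2 ⟨?_, ?_⟩
  · by_contra hA
    obtain ⟨y, hy, hyA⟩ := (isReal_comap_ofReal hK).exists_eval_ne_zero hA
    exact hyA (hzero y hy).1
  · by_contra hB
    obtain ⟨y, hy, hyB⟩ := (isReal_comap_ofReal hK).exists_eval_ne_zero hB
    exact hyB (hzero y hy).2

theorem mem_vanishingIdealC_of_sum_mem {Z : Set (Fin n → ℝ)} {s : ℕ}
    {Q : Fin s → MvPolynomial (Fin n) ℂ}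
    (h : (∑ i, starC (Q i) * Q i) ∈ vanishingIdealC Z) (i : Fin s) :
    Q i ∈ vanishingIdealC Z := by
  intro x hx
  have hsum : ∑ i, starRingEnd ℂ (evalC (Q i) x) * evalC (Q i) x = 0 := by
    have := h x hx
    rw [evalC, map_sum] at this
    rw [← this]
    refine Finset.sum_congr rfl fun j _ => ?_
    rw [map_mul, ← evalC_starC]
    rfl
  simp only [← Complex.normSq_eq_conj_mul_self, ← Complex.ofReal_sum] at hsum
  rw [Complex.ofReal_eq_zero, Finset.sum_eq_zero_iff_of_nonneg fun j _ => Complex.normSq_nonneg _]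
    at hsum
  exact Complex.normSq_eq_zero.1 (hsum i (Finset.mem_univ i))

end StarReal

theorem stmt_5 (n : ℕ) (hn : 0 < n) (I : Ideal (MvPolynomial (Fin n) ℂ))
    (hstar : ∀ P ∈ I, starC P ∈ I) :
    (∀ P ∈ vanishingIdealC (zeroSetC I), starC P ∈ vanishingIdealC (zeroSetC I)) ∧
    (∀ (s : ℕ) (Q : Fin s → MvPolynomial (Fin n) ℂ),
      (∑ i, starC (Q i) * Q i) ∈ vanishingIdealC (zeroSetC I) →
        ∀ i, Q i ∈ vanishingIdealC (zeroSetC I)) ∧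
    I ≤ vanishingIdealC (zeroSetC I) ∧
    (∀ K : Ideal (MvPolynomial (Fin n) ℂ),
      (∀ P ∈ K, starC P ∈ K) →
      (∀ (s : ℕ) (Q : Fin s → MvPolynomial (Fin n) ℂ),
        (∑ i, starC (Q i) * Q i) ∈ K → ∀ i, Q i ∈ K) →
      I ≤ K → vanishingIdealC (zeroSetC I) ≤ K) := by
  refine ⟨fun P hP x hx => ?_, fun s Q h => mem_vanishingIdealC_of_sum_mem h,
    fun P hP x hx => hx P hP, fun K hK hKr hIK => vanishingIdealC_le_of_isReal hK hKr hIK⟩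
  rw [evalC_starC, hP x hx, map_zero]
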